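/- Let d ∈ ℕ, α ∈ (0, min(2,d)) and δ ∈ (0, (d-α)/2]. Then for all t > 0 and x ∈ ℝ^d \ {0}, ∫_{ℝ^d} p̃(t,x,y) h_δ(y) dy = h_δ(x). -/

import Mathlib

open MeasureTheory Real Set Filter RealInnerProductSpace

noncomputable section

/-- Euclidean space `ℝ^d`. -/
abbrev Ed (d : ℕ) := EuclideanSpace ℝ (Fin d)

/-- Modified Bessel function of the second kind `K_ν(r)`. -/
def besselK (ν r : ℝ) : ℝ :=
  (1 / 2) * (r / 2) ^ ν * ∫ u in Ioi (0 : ℝ), u ^ (-ν - 1) * Real.exp (-u - r ^ 2 / (4 * u))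

/-- Relativistic `α`-stable heat kernel with mass parameter `m`:
`p^m(t,x,y) = (2π)^{-d} ∫ exp(-i⟨y-x,z⟩) exp(-t(|z|²+m^{2/α})^{α/2}) dz`
(the integral is real, and equals the cosine integral below). -/
def relKernel (d : ℕ) (α m t : ℝ) (x y : Ed d) : ℝ :=
  (2 * π) ^ (-(d : ℝ)) *
    ∫ z : Ed d, Real.cos ⟪y - x, z⟫ * Real.exp (-t * (‖z‖ ^ 2 + m ^ (2 / α)) ^ (α / 2))

/-- Fractional (`α`-stable) heat kernel `p⁰(t,x,y)`. -/
def fracKernel (d : ℕ) (α t : ℝ) (x y : Ed d) : ℝ :=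
  (2 * π) ^ (-(d : ℝ)) * ∫ z : Ed d, Real.cos ⟪y - x, z⟫ * Real.exp (-t * ‖z‖ ^ α)

/-- The summands of the perturbation series. -/
def pertN (d : ℕ) (k : ℝ → Ed d → Ed d → ℝ) (q : Ed d → ℝ) : ℕ → ℝ → Ed d → Ed d → ℝ
  | 0 => k
  | n + 1 => fun t x y =>
      ∫ s in Ioo (0 : ℝ) t, ∫ z : Ed d, pertN d k q n s x z * q z * k (t - s) z y

/-- Schrödinger perturbation of a transition density `k` by a potential `q`. -/
def pert (d : ℕ) (k : ℝ → Ed d → Ed d → ℝ) (q : Ed d → ℝ) (t : ℝ) (x y : Ed d) : ℝ :=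
  ∑' n : ℕ, pertN d k q n t x y

/-- Radial profile of the potential `V_β`. -/
def VProf (d : ℕ) (α β r : ℝ) : ℝ :=
  2 ^ (α / 2) * Real.Gamma (((d : ℝ) - β) / 2) / Real.Gamma (((d : ℝ) - β - α) / 2) *
    (besselK ((β + α) / 2) r / besselK (β / 2) r) * r ^ (-(α / 2))

/-- The potential `V_β(x)`. -/
def Vbeta (d : ℕ) (α β : ℝ) (x : Ed d) : ℝ := VProf d α β ‖x‖

/-- The Hardy constant `κ_β` for the fractional Laplacian. -/
def kappa (d : ℕ) (α β : ℝ) : ℝ :=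
  2 ^ α * Real.Gamma ((β + α) / 2) * Real.Gamma (((d : ℝ) - β) / 2) /
    (Real.Gamma (β / 2) * Real.Gamma (((d : ℝ) - β - α) / 2))

/-- `h^m_β(x) = ∫_0^∞ t^{(d-α-β)/α} p^m(t,x,0) dt`. -/
def hBetaM (d : ℕ) (α m β : ℝ) (x : Ed d) : ℝ :=
  ∫ t in Ioi (0 : ℝ), t ^ (((d : ℝ) - α - β) / α) * relKernel d α m t x 0

/-- `h_β = h^1_β`. -/
def hBeta (d : ℕ) (α β : ℝ) (x : Ed d) : ℝ := hBetaM d α 1 β x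

/-- `V^m_β(x) = ((d-α-β)/α) h^m_{β+α}(x)/h^m_β(x)`. -/
def VbetaM (d : ℕ) (α m β : ℝ) (x : Ed d) : ℝ :=
  (((d : ℝ) - α - β) / α) * hBetaM d α m (β + α) x / hBetaM d α m β x

/-- The function `H⁰(t,x)`. -/
def Hzero (d : ℕ) (α δ t : ℝ) (x : Ed d) : ℝ :=
  if δ ≤ ((d : ℝ) - α) / 2 then 1 + t ^ (δ / α) * ‖x‖ ^ (-δ)
  else 1 + t ^ (((d : ℝ) - α - δ) / α) * ‖x‖ ^ (-((d : ℝ) - α - δ))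

/-- Density of the Lévy measure of the relativistic `α`-stable operator (mass 1). -/
def levyNu (d : ℕ) (α : ℝ) (x : Ed d) : ℝ :=
  2 ^ ((α - (d : ℝ)) / 2 + 1) * π ^ (-(d : ℝ) / 2) * |Real.Gamma (-α / 2)|⁻¹ *
    besselK (((d : ℝ) + α) / 2) ‖x‖ / ‖x‖ ^ (((d : ℝ) + α) / 2)


theorem gauss_cexp {d : ℕ} (b : ℝ) (hb : 0 < b) (x : Ed d) :
    ∫ z : Ed d, Complex.exp ((⟪x, z⟫ : ℝ) * Complex.I) * (Real.exp (-b * ‖z‖ ^ 2) : ℂ) =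
      (((π / b) ^ ((d : ℝ) / 2) * Real.exp (-‖x‖ ^ 2 / (4 * b)) : ℝ) : ℂ) := by
  have h := GaussianFourier.integral_cexp_neg_mul_sq_norm_add (V := Ed d)
    (show 0 < (b : ℂ).re from hb) Complex.I x
  have e : ∀ z : Ed d, Complex.exp ((⟪x, z⟫ : ℝ) * Complex.I) * (Real.exp (-b * ‖z‖ ^ 2) : ℂ)
      = Complex.exp (-(b : ℂ) * ‖z‖ ^ 2 + Complex.I * (⟪x, z⟫ : ℝ)) := by
    intro z
    push_cast
    rw [← Complex.exp_add]
    ring_nf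
  simp_rw [e]
  rw [h]
  push_cast
  rw [Complex.ofReal_cpow (by positivity)]
  simp

theorem gauss_integrable {d : ℕ} (b : ℝ) (hb : 0 < b) :
    Integrable (fun z : Ed d => Real.exp (-b * ‖z‖ ^ 2)) := by
  have h := GaussianFourier.integrable_cexp_neg_mul_sq_norm_add (V := Ed d)
    (show 0 < (b : ℂ).re from hb) 0 0
  have := h.norm
  refine this.congr (ae_of_all _ fun z => ?_)
  simp only [Complex.norm_exp]
  simp [← Complex.ofReal_pow]

theorem gauss_integral {d : ℕ} (b : ℝ) (hb : 0 < b) :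
    ∫ z : Ed d, Real.exp (-b * ‖z‖ ^ 2) = (π / b) ^ ((d : ℝ) / 2) := by
  have := GaussianFourier.integral_rexp_neg_mul_sq_norm (V := Ed d) hb
  simpa using this

/-- real part of a Fourier integral -/
theorem re_fourier {d : ℕ} (f : Ed d → ℝ) (hf : Integrable f) (x : Ed d) :
    (∫ z : Ed d, Complex.exp ((⟪x, z⟫ : ℝ) * Complex.I) * (f z : ℂ)).re
      = ∫ z : Ed d, Real.cos ⟪x, z⟫ * f z := by
  have hi : Integrable (fun z : Ed d => Complex.exp ((⟪x, z⟫ : ℝ) * Complex.I) * (f z : ℂ)) := by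
    refine hf.ofReal.bdd_mul (c := 1) ?_ (ae_of_all _ fun z => ?_)
    · exact (by fun_prop : Continuous fun z : Ed d => Complex.exp ((⟪x, z⟫ : ℝ) * Complex.I)).aestronglyMeasurable
    · rw [Complex.norm_exp_ofReal_mul_I]
  have := integral_re hi
  simp only [RCLike.re_to_complex] at this
  rw [← this]
  congr 1; ext z
  simp [Complex.exp_ofReal_mul_I_re]

theorem gauss_cos {d : ℕ} (b : ℝ) (hb : 0 < b) (x : Ed d) :
    ∫ z : Ed d, Real.cos ⟪x, z⟫ * Real.exp (-b * ‖z‖ ^ 2) =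
      (π / b) ^ ((d : ℝ) / 2) * Real.exp (-‖x‖ ^ 2 / (4 * b)) := by
  rw [← re_fourier _ (gauss_integrable b hb), gauss_cexp b hb, Complex.ofReal_re]

theorem cos_mul_integrable {d : ℕ} {f : Ed d → ℝ} (hf : Integrable f) (x : Ed d) :
    Integrable (fun z : Ed d => Real.cos ⟪x, z⟫ * f z) := by
  refine hf.bdd_mul (c := 1) ?_ (ae_of_all _ fun z => ?_)
  · exact (by fun_prop : Continuous fun z : Ed d => Real.cos ⟪x, z⟫).aestronglyMeasurable
  · exact Real.abs_cos_le_one _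

/-- Gaussian-regularized cosine transforms are nonnegative and radially nonincreasing. -/
def GoodF {d : ℕ} (F : Ed d → ℝ) : Prop :=
  ∀ η > 0, ∀ x y : Ed d, ‖x‖ ≤ ‖y‖ →
    0 ≤ ∫ z : Ed d, Real.cos ⟪y, z⟫ * (F z * Real.exp (-η * ‖z‖ ^ 2)) ∧
    ∫ z : Ed d, Real.cos ⟪y, z⟫ * (F z * Real.exp (-η * ‖z‖ ^ 2)) ≤
      ∫ z : Ed d, Real.cos ⟪x, z⟫ * (F z * Real.exp (-η * ‖z‖ ^ 2))

theorem good_poly {d : ℕ} (p : Polynomial ℝ) (hp : ∀ k, 0 ≤ p.coeff k) (ε : ℝ) (hε : 0 < ε) :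
    GoodF (fun z : Ed d => p.eval (Real.exp (-ε * (‖z‖ ^ 2 + 1)))) := by
  intro η hη x y hxy
  have key : ∀ x : Ed d, ∫ z : Ed d, Real.cos ⟪x, z⟫ *
      (p.eval (Real.exp (-ε * (‖z‖ ^ 2 + 1))) * Real.exp (-η * ‖z‖ ^ 2)) =
      ∑ k ∈ Finset.range (p.natDegree + 1), p.coeff k * Real.exp (-ε * k) *
        ((π / (η + ε * k)) ^ ((d : ℝ) / 2) * Real.exp (-‖x‖ ^ 2 / (4 * (η + ε * k)))) := by
    intro x
    have e : ∀ z : Ed d, Real.cos ⟪x, z⟫ *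
      (p.eval (Real.exp (-ε * (‖z‖ ^ 2 + 1))) * Real.exp (-η * ‖z‖ ^ 2)) =
      ∑ k ∈ Finset.range (p.natDegree + 1), p.coeff k * Real.exp (-ε * k) *
        (Real.cos ⟪x, z⟫ * Real.exp (-(η + ε * k) * ‖z‖ ^ 2)) := by
      intro z
      rw [Polynomial.eval_eq_sum_range, Finset.sum_mul, Finset.mul_sum]
      refine Finset.sum_congr rfl fun k _ => ?_
      rw [← Real.exp_nat_mul]
      have : Real.exp (k * (-ε * (‖z‖ ^ 2 + 1))) * Real.exp (-η * ‖z‖ ^ 2) =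
        Real.exp (-ε * k) * Real.exp (-(η + ε * k) * ‖z‖ ^ 2) := by
        rw [← Real.exp_add, ← Real.exp_add]; ring_nf
      linear_combination p.coeff k * Real.cos ⟪x, z⟫ * this
    simp_rw [e]
    rw [integral_finsetSum]
    · refine Finset.sum_congr rfl fun k _ => ?_
      rw [integral_const_mul, gauss_cos _ (by positivity)]
    · intro k _
      exact (cos_mul_integrable (gauss_integrable _ (by positivity)) x).const_mul _
  rw [key, key]
  constructor
  · refine Finset.sum_nonneg fun k _ => ?_
    have := hp k
    positivity
  · refine Finset.sum_le_sum fun k _ => ?_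
    have := hp k
    gcongr

theorem good_lim {d : ℕ} (F : ℕ → Ed d → ℝ) (G : Ed d → ℝ) (C : ℝ)
    (hm : ∀ n, Measurable (F n)) (hC : ∀ n z, |F n z| ≤ C)
    (hl : ∀ z, Tendsto (fun n => F n z) atTop (nhds (G z))) (hg : ∀ n, GoodF (F n)) : GoodF G := by
  intro η hη x y hxy
  have T : ∀ x : Ed d, Tendsto (fun n => ∫ z : Ed d, Real.cos ⟪x, z⟫ * (F n z * Real.exp (-η * ‖z‖ ^ 2)))
      atTop (nhds (∫ z : Ed d, Real.cos ⟪x, z⟫ * (G z * Real.exp (-η * ‖z‖ ^ 2)))) := by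
    intro x
    refine tendsto_integral_of_dominated_convergence (fun z => C * Real.exp (-η * ‖z‖ ^ 2)) ?_
      ((gauss_integrable η hη).const_mul C) ?_ ?_
    · intro n
      have := hm n
      exact (by fun_prop : Measurable _).aestronglyMeasurable
    · intro n
      refine ae_of_all _ fun z => ?_
      rw [norm_mul, norm_mul, Real.norm_of_nonneg (Real.exp_nonneg _)]
      calc ‖Real.cos ⟪x, z⟫‖ * (‖F n z‖ * Real.exp (-η * ‖z‖ ^ 2))
          ≤ 1 * (C * Real.exp (-η * ‖z‖ ^ 2)) := by
            gcongr
            · exact Real.abs_cos_le_one _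
            · exact hC n z
        _ = _ := one_mul _
    · refine ae_of_all _ fun z => ?_
      exact ((hl z).mul_const _).const_mul _
  exact ⟨ge_of_tendsto' (T y) fun n => (hg n η hη x y hxy).1,
    le_of_tendsto_of_tendsto' (T y) (T x) fun n => (hg n η hη x y hxy).2⟩



theorem choose_sign (a : ℝ) (h0 : 0 < a) (h1 : a < 1) (n : ℕ) :
    0 ≤ -((-1) ^ (n + 1) * Ring.choose a (n + 1)) := by
  have hrec : ∀ n : ℕ, Ring.choose a (n + 1) = Ring.choose a n * (a - n) / (n + 1) := by
    intro n
    rw [Ring.choose_eq_smul, Ring.choose_eq_smul, descPochhammer_succ_right, Polynomial.smeval_mul]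
    simp only [Nat.factorial_succ, smul_eq_mul, Polynomial.smeval_sub, Polynomial.smeval_X,
      pow_one]
    rw [Polynomial.smeval_natCast]
    push_cast
    have : (n.factorial : ℝ) ≠ 0 := by positivity
    have : (n + 1 : ℝ) ≠ 0 := by positivity
    field_simp
    simp
  induction n with
  | zero => simp [Ring.choose_one_right]; exact h0.le
  | succ n ih =>
    rw [hrec (n + 1), pow_succ]
    have e : -((-1) ^ (n + 1) * -1 * (Ring.choose a (n + 1) * (a - ((n + 1 : ℕ) : ℝ)) / (((n + 1 : ℕ) : ℝ) + 1)))
       = (-((-1) ^ (n + 1) * Ring.choose a (n + 1))) * (((n + 1 : ℕ) - a : ℝ) / (((n + 1 : ℕ) : ℝ) + 1)) := by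
      ring
    rw [e]
    refine mul_nonneg ih (div_nonneg ?_ (by positivity))
    push_cast
    have : (0 : ℝ) ≤ n := by positivity
    linarith

theorem binom_hasSum (a x : ℝ) (hx0 : 0 ≤ x) (hx1 : x < 1) :
    HasSum (fun n : ℕ => -((-1) ^ (n + 1) * Ring.choose a (n + 1)) * x ^ (n + 1))
      (1 - (1 - x) ^ a) := by
  have h := (Real.one_add_rpow_hasFPowerSeriesOnBall_zero (a := a)).hasSum (y := -x) (by
    simp [abs_of_nonneg hx0, hx1, edist_dist])
  simp only [binomialSeries_apply, zero_add, List.ofFn_const, List.prod_replicate, smul_eq_mul] at h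
  rw [← hasSum_nat_add_iff' 1] at h
  simp at h
  have h2 := h.neg
  have e1 : (fun n : ℕ => -((-1) ^ (n + 1) * Ring.choose a (n + 1)) * x ^ (n + 1)) =
      fun n : ℕ => -(Ring.choose a (n + 1) * (-x) ^ (n + 1)) := by
    funext n
    rw [neg_pow x]; ring
  rw [e1]
  have e2 : 1 - (1 - x) ^ a = -((1 + -x) ^ a - 1) := by
    rw [← sub_eq_add_neg]; ring
  rw [e2]
  exact h2

theorem good_step (d : ℕ) (a T ε : ℝ) (h0 : 0 < a) (h1 : a < 1) (hT : 0 ≤ T) (hε : 0 < ε) :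
    GoodF (fun z : Ed d => Real.exp (-T * (1 - Real.exp (-ε * (‖z‖ ^ 2 + 1))) ^ a)) := by
  set c : ℕ → ℝ := fun n => -((-1) ^ (n + 1) * Ring.choose a (n + 1)) with hc
  have hcn : ∀ n, 0 ≤ c n := choose_sign a h0 h1
  let q : ℕ → Polynomial ℝ := fun n => ∑ k ∈ Finset.range n, Polynomial.C (c k) * Polynomial.X ^ (k + 1)
  let P : ℕ → Polynomial ℝ := fun n =>
    Polynomial.C (Real.exp (-T)) * (Polynomial.C 1 + Polynomial.C (T / n) * q n) ^ n
  have mulc : ∀ p r : Polynomial ℝ, (∀ k, 0 ≤ p.coeff k) → (∀ k, 0 ≤ r.coeff k) →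
      ∀ k, 0 ≤ (p * r).coeff k := by
    intro p r hp hr k
    rw [Polynomial.coeff_mul]
    exact Finset.sum_nonneg fun i _ => mul_nonneg (hp _) (hr _)
  have cc : ∀ b : ℝ, 0 ≤ b → ∀ k, 0 ≤ (Polynomial.C b).coeff k := by
    intro b hb k
    rw [Polynomial.coeff_C]; split_ifs <;> simp [hb]
  have powc : ∀ (p : Polynomial ℝ) (n : ℕ), (∀ k, 0 ≤ p.coeff k) → ∀ k, 0 ≤ (p ^ n).coeff k := by
    intro p n hp
    induction n with
    | zero => simpa using cc 1 zero_le_one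
    | succ n ih => rw [pow_succ]; exact mulc _ _ ih hp
  have hq : ∀ n k, 0 ≤ (q n).coeff k := by
    intro n k
    simp only [q, Polynomial.finsetSum_coeff]
    refine Finset.sum_nonneg fun i _ => ?_
    refine mulc _ _ (cc _ (hcn i)) (powc _ _ fun k => ?_) k
    rw [Polynomial.coeff_X]; split_ifs <;> simp
  have hP : ∀ n k, 0 ≤ (P n).coeff k := by
    intro n
    refine mulc _ _ (cc _ (Real.exp_nonneg _)) (powc _ _ fun k => ?_)
    rw [Polynomial.coeff_add]
    exact add_nonneg (cc 1 zero_le_one k) (mulc _ _ (cc _ (by positivity)) (hq n) k)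
  have ev : ∀ n x, (P n).eval x =
      Real.exp (-T) * (1 + T / n * ∑ k ∈ Finset.range n, c k * x ^ (k + 1)) ^ n := by
    intro n x
    simp [P, q, Polynomial.eval_finsetSum]
  have hx : ∀ z : Ed d, Real.exp (-ε * (‖z‖ ^ 2 + 1)) < 1 := fun z => by
    rw [Real.exp_lt_one_iff]
    have : 0 < ε * (‖z‖ ^ 2 + 1) := by positivity
    linarith
  refine good_lim (fun n z => (P n).eval (Real.exp (-ε * (‖z‖ ^ 2 + 1)))) _ 1 ?_ ?_ ?_
    (fun n => good_poly (P n) (hP n) ε hε)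
  · intro n
    refine Continuous.measurable ?_
    exact (P n).continuous.comp (by fun_prop)
  · intro n z
    have hs := binom_hasSum a _ (Real.exp_nonneg _) (hx z)
    set x := Real.exp (-ε * (‖z‖ ^ 2 + 1)) with hxd
    have x0 : 0 ≤ x := Real.exp_nonneg _
    have l1 : ∑ k ∈ Finset.range n, c k * x ^ (k + 1) ≤ 1 := by
      refine (sum_le_hasSum _ (fun i _ => mul_nonneg (hcn i) (by positivity)) hs).trans ?_
      have := Real.rpow_nonneg (sub_nonneg.2 (hx z).le) a
      rw [← hxd] at this
      linarith
    have l0 : 0 ≤ ∑ k ∈ Finset.range n, c k * x ^ (k + 1) :=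
      Finset.sum_nonneg fun i _ => mul_nonneg (hcn i) (by positivity)
    rw [ev, abs_of_nonneg (by positivity)]
    rcases Nat.eq_zero_or_pos n with rfl | hn
    · simp [hT]
    · have : (1 + T / n * ∑ k ∈ Finset.range n, c k * x ^ (k + 1)) ^ n ≤ Real.exp T := by
        calc (1 + T / n * ∑ k ∈ Finset.range n, c k * x ^ (k + 1)) ^ n
            ≤ (1 + T / n * 1) ^ n := by gcongr
          _ ≤ (Real.exp (T / n)) ^ n := by
            gcongr
            rw [mul_one, add_comm]; exact Real.add_one_le_exp _
          _ = Real.exp T := by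
            rw [← Real.exp_nat_mul]; congr 1; field_simp
      calc _ ≤ Real.exp (-T) * Real.exp T := by gcongr
        _ = 1 := by rw [← Real.exp_add]; simp
  · intro z
    have hs := (binom_hasSum a _ (Real.exp_nonneg _) (hx z)).tendsto_sum_nat
    set x := Real.exp (-ε * (‖z‖ ^ 2 + 1)) with hxd
    simp_rw [ev]
    have e : Real.exp (-T * (1 - x) ^ a) = Real.exp (-T) * Real.exp (T * (1 - (1 - x) ^ a)) := by
      rw [← Real.exp_add]; ring_nf
    rw [e]
    refine Tendsto.const_mul _ ?_
    refine Real.tendsto_one_add_pow_exp_of_tendsto ?_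
    refine (hs.const_mul T).congr' ?_
    filter_upwards [eventually_gt_atTop 0] with n hn
    have : (n : ℝ) ≠ 0 := by positivity
    simp only [hc]
    field_simp

theorem good_phi (d : ℕ) (a t : ℝ) (h0 : 0 < a) (h1 : a < 1) (ht : 0 ≤ t) :
    GoodF (fun z : Ed d => Real.exp (-t * (‖z‖ ^ 2 + 1) ^ a)) := by
  let ε : ℕ → ℝ := fun n => 1 / ((n : ℝ) + 1)
  have hε : ∀ n, 0 < ε n := fun n => by positivity
  have hεt : Tendsto ε atTop (nhds 0) := tendsto_one_div_add_atTop_nhds_zero_nat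
  refine good_lim (fun n z => Real.exp (-(t * (1 / ε n) ^ a) *
      (1 - Real.exp (-ε n * (‖z‖ ^ 2 + 1))) ^ a)) _ 1 ?_ ?_ ?_
    (fun n => good_step d a _ _ h0 h1 (by have := hε n; positivity) (hε n))
  · intro n
    fun_prop
  · intro n z
    have := hε n
    have : 0 ≤ 1 - Real.exp (-ε n * (‖z‖ ^ 2 + 1)) := by
      rw [sub_nonneg, Real.exp_le_one_iff]
      have : 0 ≤ ε n * (‖z‖ ^ 2 + 1) := by positivity
      linarith
    rw [abs_of_nonneg (Real.exp_nonneg _), Real.exp_le_one_iff]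
    rw [neg_mul, neg_nonpos]
    positivity
  · intro z
    set v := ‖z‖ ^ 2 + 1 with hv
    have hvp : 0 < v := by positivity
    have hd : HasDerivAt (fun s : ℝ => 1 - Real.exp (-s * v)) v 0 := by
      have h1 : HasDerivAt (fun s : ℝ => -s * v) (-1 * v) 0 := (hasDerivAt_id (0:ℝ)).neg.mul_const v
      have := h1.exp.const_sub 1
      simpa using this
    have hsl := hd.tendsto_slope_zero_right
    have hlim : Tendsto (fun n => (1 / ε n) * (1 - Real.exp (-ε n * v))) atTop (nhds v) := by
      have : Tendsto ε atTop (nhdsWithin 0 (Ioi 0)) :=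
        tendsto_nhdsWithin_iff.2 ⟨hεt, Eventually.of_forall hε⟩
      have h3 := hsl.comp this
      refine h3.congr fun n => ?_
      simp
    refine (Real.continuous_exp.tendsto _).comp ?_
    have h4 := (hlim.rpow_const (p := a) (Or.inl hvp.ne')).const_mul (-t)
    refine h4.congr fun n => ?_
    have := hε n
    have : 0 ≤ 1 - Real.exp (-ε n * v) := by
      rw [sub_nonneg, Real.exp_le_one_iff]
      have : 0 ≤ ε n * v := by positivity
      linarith
    rw [Real.mul_rpow (by positivity) this]
    ring


/-- Fourier multiplier. -/
def phi (d : ℕ) (a t : ℝ) (z : Ed d) : ℝ := Real.exp (-t * (‖z‖ ^ 2 + 1) ^ a)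

/-- Convolution kernel. -/
def pk (d : ℕ) (a t : ℝ) (w : Ed d) : ℝ :=
  (2 * π) ^ (-(d : ℝ)) * ∫ z : Ed d, Real.cos ⟪w, z⟫ * phi d a t z

theorem relKernel_eq (d : ℕ) (α t : ℝ) (x y : Ed d) :
    relKernel d α 1 t x y = pk d (α / 2) t (y - x) := by
  simp only [relKernel, pk, phi, Real.one_rpow]

theorem phi_nonneg (d : ℕ) (a t : ℝ) (z : Ed d) : 0 ≤ phi d a t z := Real.exp_nonneg _

theorem phi_cont (d : ℕ) (a t : ℝ) : Continuous (phi d a t) := by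
  unfold phi
  refine Real.continuous_exp.comp (continuous_const.mul ?_)
  exact (by fun_prop : Continuous fun z : Ed d => ‖z‖ ^ 2 + 1).rpow_const
    (fun z => Or.inl (by positivity))

theorem phi_le_one (d : ℕ) (a t : ℝ) (ht : 0 ≤ t) (z : Ed d) : phi d a t z ≤ 1 := by
  unfold phi
  rw [Real.exp_le_one_iff, neg_mul, neg_nonpos]
  positivity

theorem phi_integrable (d : ℕ) (a t : ℝ) (ha : 0 < a) (ht : 0 < t) : Integrable (phi d a t) := by
  obtain ⟨n, hn⟩ := exists_nat_gt (((d : ℝ) + 1) / 2 / a)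
  have hn' : ((d : ℝ) + 1) / 2 ≤ a * n := by
    rw [div_lt_iff₀ ha] at hn; linarith
  have hi : Integrable (fun z : Ed d => (1 + ‖z‖ ^ 2) ^ (-((d : ℝ) + 1) / 2)) := by
    have := integrable_rpow_neg_one_add_norm_sq (E := Ed d) (μ := volume) (r := (d : ℝ) + 1) (by simp)
    exact this
  refine (hi.const_mul (n.factorial * t⁻¹ ^ n)).mono' (phi_cont d a t).aestronglyMeasurable
    (ae_of_all _ fun z => ?_)
  rw [Real.norm_of_nonneg (phi_nonneg ..)]
  unfold phi
  rw [add_comm (‖z‖ ^ 2) 1]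
  set v := 1 + ‖z‖ ^ 2 with hv
  have hv1 : 1 ≤ v := by rw [hv]; nlinarith [sq_nonneg ‖z‖]
  have hv0 : 0 < v := by linarith
  have hva : 0 < v ^ a := by positivity
  have h1 := Real.pow_div_factorial_le_exp (t * v ^ a) (by positivity) n
  have h2 : Real.exp (-t * v ^ a) ≤ n.factorial / (t * v ^ a) ^ n := by
    rw [neg_mul, Real.exp_neg, inv_le_comm₀ (Real.exp_pos _) (by positivity), inv_div]
    exact h1
  refine h2.trans ?_
  rw [mul_pow, inv_pow, mul_assoc, div_eq_mul_inv, mul_inv]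
  gcongr
  rw [← Real.rpow_natCast, ← Real.rpow_mul hv0.le, ← Real.rpow_neg hv0.le]
  apply Real.rpow_le_rpow_of_exponent_le hv1
  linarith

theorem pk_good (d : ℕ) (a t : ℝ) (h0 : 0 < a) (h1 : a < 1) (ht : 0 < t) (x y : Ed d)
    (hxy : ‖x‖ ≤ ‖y‖) : 0 ≤ pk d a t y ∧ pk d a t y ≤ pk d a t x := by
  let ε : ℕ → ℝ := fun n => 1 / ((n : ℝ) + 1)
  have hε : ∀ n, 0 < ε n := fun n => by positivity
  have hεt : Tendsto ε atTop (nhds 0) := tendsto_one_div_add_atTop_nhds_zero_nat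
  have T : ∀ x : Ed d, Tendsto (fun n => ∫ z : Ed d, Real.cos ⟪x, z⟫ *
      (phi d a t z * Real.exp (-ε n * ‖z‖ ^ 2)))
      atTop (nhds (∫ z : Ed d, Real.cos ⟪x, z⟫ * phi d a t z)) := by
    intro x
    refine tendsto_integral_of_dominated_convergence (phi d a t) ?_
      (phi_integrable d a t h0 ht) ?_ ?_
    · intro n
      have := phi_cont d a t
      exact (by fun_prop : Continuous _).aestronglyMeasurable
    · intro n
      refine ae_of_all _ fun z => ?_
      rw [norm_mul, norm_mul, Real.norm_of_nonneg (Real.exp_nonneg _),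
        Real.norm_of_nonneg (phi_nonneg ..)]
      calc ‖Real.cos ⟪x, z⟫‖ * (phi d a t z * Real.exp (-ε n * ‖z‖ ^ 2))
          ≤ 1 * (phi d a t z * 1) := by
            have := phi_nonneg d a t z
            gcongr
            · exact Real.abs_cos_le_one _
            · rw [Real.exp_le_one_iff, neg_mul, neg_nonpos]
              have := hε n
              positivity
        _ = _ := by ring
    · refine ae_of_all _ fun z => ?_
      have : Tendsto (fun n => Real.exp (-ε n * ‖z‖ ^ 2)) atTop (nhds 1) := by
        have h : Tendsto (fun n => -ε n * ‖z‖ ^ 2) atTop (nhds 0) := by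
          simpa using hεt.neg.mul_const (‖z‖ ^ 2)
        have h2 := (Real.continuous_exp.tendsto 0).comp h; rw [Real.exp_zero] at h2; exact h2
      simpa using (this.const_mul (phi d a t z)).const_mul (Real.cos ⟪x, z⟫)
  have g := good_phi d a t h0 h1 ht.le
  have e1 := ge_of_tendsto' (T y) fun n => (g (ε n) (hε n) x y hxy).1
  have e2 := le_of_tendsto_of_tendsto' (T y) (T x) fun n => (g (ε n) (hε n) x y hxy).2
  unfold pk
  constructor
  · positivity
  · gcongr

theorem pk_nonneg (d : ℕ) (a t : ℝ) (h0 : 0 < a) (h1 : a < 1) (ht : 0 < t) (x : Ed d) :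
    0 ≤ pk d a t x := (pk_good d a t h0 h1 ht x x le_rfl).1

theorem pk_neg (d : ℕ) (a t : ℝ) (x : Ed d) : pk d a t (-x) = pk d a t x := by
  simp [pk]

theorem pk_meas (d : ℕ) (a : ℝ) : Measurable (fun q : ℝ × Ed d => pk d a q.1 q.2) := by
  unfold pk
  refine Measurable.const_mul ?_ _
  have : StronglyMeasurable (fun q : (ℝ × Ed d) × Ed d => Real.cos ⟪q.1.2, q.2⟫ * phi d a q.1.1 q.2) := by
    unfold phi
    exact (by fun_prop : Measurable _).stronglyMeasurable
  exact this.integral_prod_right.measurable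

theorem pk_meas1 (d : ℕ) (a t : ℝ) : Measurable (pk d a t) := by
  unfold pk
  refine Measurable.const_mul ?_ _
  have : StronglyMeasurable (fun q : Ed d × Ed d => Real.cos ⟪q.1, q.2⟫ * phi d a t q.2) := by
    unfold phi
    exact (by fun_prop : Measurable _).stronglyMeasurable
  exact this.integral_prod_right.measurable

/-- odd part vanishes -/
theorem sin_phi (d : ℕ) (a t : ℝ) (w : Ed d) :
    ∫ z : Ed d, Real.sin ⟪w, z⟫ * phi d a t z = 0 := by
  have h := integral_neg_eq_self (fun z : Ed d => Real.sin ⟪w, z⟫ * phi d a t z) volume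
  have e : ∀ z : Ed d, Real.sin ⟪w, -z⟫ * phi d a t (-z) = -(Real.sin ⟪w, z⟫ * phi d a t z) := by
    intro z; simp [phi]
  simp_rw [e] at h
  rw [integral_neg] at h
  linarith

theorem cexp_integrable {d : ℕ} {f : Ed d → ℝ} (hf : Integrable f) (x : Ed d) :
    Integrable (fun z : Ed d => Complex.exp ((⟪x, z⟫ : ℝ) * Complex.I) * (f z : ℂ)) := by
  refine hf.ofReal.bdd_mul (c := 1) ?_ (ae_of_all _ fun z => ?_)
  · exact (by fun_prop : Continuous fun z : Ed d => Complex.exp ((⟪x, z⟫ : ℝ) * Complex.I)).aestronglyMeasurable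
  · rw [Complex.norm_exp_ofReal_mul_I]

theorem im_fourier {d : ℕ} (f : Ed d → ℝ) (hf : Integrable f) (x : Ed d) :
    (∫ z : Ed d, Complex.exp ((⟪x, z⟫ : ℝ) * Complex.I) * (f z : ℂ)).im
      = ∫ z : Ed d, Real.sin ⟪x, z⟫ * f z := by
  have := integral_im (cexp_integrable hf x)
  simp only [RCLike.im_to_complex] at this
  rw [← this]
  congr 1; ext z
  simp [Complex.exp_ofReal_mul_I_im]

theorem pk_complex (d : ℕ) (a t : ℝ) (h0 : 0 < a) (ht : 0 < t) (w : Ed d) :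
    (pk d a t w : ℂ) = ((2 * π) ^ (-(d : ℝ)) : ℝ) *
      ∫ z : Ed d, Complex.exp ((⟪w, z⟫ : ℝ) * Complex.I) * (phi d a t z : ℂ) := by
  have hi := phi_integrable d a t h0 ht
  apply Complex.ext
  · rw [Complex.re_ofReal_mul, re_fourier _ hi, Complex.ofReal_re]; rfl
  · rw [Complex.im_ofReal_mul, im_fourier _ hi, sin_phi, mul_zero, Complex.ofReal_im]

theorem pk_gauss_le (d : ℕ) (a t : ℝ) (h0 : 0 < a) (h1 : a < 1) (ht : 0 < t) (η : ℝ) (hη : 0 < η) :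
    ∫⁻ w : Ed d, ENNReal.ofReal (pk d a t w * Real.exp (-η * ‖w‖ ^ 2)) ≤ 1 := by
    have hi := phi_integrable d a t h0 ht
    have hm : Measurable (pk d a t) := pk_meas1 d a t
    have hb : ∀ w, |pk d a t w| ≤ pk d a t 0 := fun w => by
      rw [abs_of_nonneg (pk_nonneg d a t h0 h1 ht w)]
      exact (pk_good d a t h0 h1 ht 0 w (by simp)).2
    have hg := gauss_integrable (d := d) η hη
    have hfint : Integrable (fun w : Ed d => pk d a t w * Real.exp (-η * ‖w‖ ^ 2)) :=
      hg.bdd_mul (c := pk d a t 0) hm.aestronglyMeasurable (ae_of_all _ fun w => hb w)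
    rw [← ofReal_integral_eq_lintegral_ofReal hfint (ae_of_all _ fun w =>
      mul_nonneg (pk_nonneg d a t h0 h1 ht w) (Real.exp_nonneg _))]
    rw [ENNReal.ofReal_le_one]
    have e1 : ∀ w : Ed d, pk d a t w * Real.exp (-η * ‖w‖ ^ 2) = (2 * π) ^ (-(d : ℝ)) *
        ∫ z : Ed d, Real.cos ⟪w, z⟫ * phi d a t z * Real.exp (-η * ‖w‖ ^ 2) := by
      intro w; rw [integral_mul_const, pk]; ring
    simp_rw [e1]
    rw [integral_const_mul, integral_integral_swap]
    · have e2 : ∀ z : Ed d, ∫ w : Ed d, Real.cos ⟪w, z⟫ * phi d a t z * Real.exp (-η * ‖w‖ ^ 2) =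
          phi d a t z * ((π / η) ^ ((d : ℝ) / 2) * Real.exp (-‖z‖ ^ 2 / (4 * η))) := by
        intro z
        rw [← gauss_cos η hη z, ← integral_const_mul]
        congr 1; ext w
        rw [real_inner_comm]; ring
      simp_rw [e2]
      have e3 : ∀ z : Ed d, Real.exp (-‖z‖ ^ 2 / (4 * η)) = Real.exp (-(1 / (4 * η)) * ‖z‖ ^ 2) := by
        intro z; congr 1; ring
      simp_rw [e3]
      have hg2 := gauss_integrable (d := d) (1 / (4 * η)) (by positivity)
      calc (2 * π) ^ (-(d : ℝ)) * ∫ z : Ed d, phi d a t z * ((π / η) ^ ((d : ℝ) / 2) *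
              Real.exp (-(1 / (4 * η)) * ‖z‖ ^ 2))
          ≤ (2 * π) ^ (-(d : ℝ)) * ∫ z : Ed d, ((π / η) ^ ((d : ℝ) / 2) *
              Real.exp (-(1 / (4 * η)) * ‖z‖ ^ 2)) := by
            gcongr
            · refine (hg2.const_mul _).bdd_mul (c := 1) (phi_cont d a t).aestronglyMeasurable
                (ae_of_all _ fun z => ?_)
              rw [Real.norm_of_nonneg (phi_nonneg ..)]
              exact phi_le_one d a t ht.le z
            · exact hg2.const_mul _
            · intro z
              exact mul_le_of_le_one_left (by positivity) (phi_le_one d a t ht.le z)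
        _ = 1 := by
            rw [integral_const_mul, gauss_integral _ (by positivity), ← Real.mul_rpow (by positivity)
              (by positivity)]
            have : π / η * (π / (1 / (4 * η))) = (2 * π) ^ (2 : ℝ) := by
              rw [Real.rpow_two]; field_simp; ring
            rw [this, ← Real.rpow_mul (by positivity), ← Real.rpow_add (by positivity)]
            convert Real.rpow_zero _ using 2
            ring
    · have hp := hg.mul_prod hi
      have := hp.bdd_mul (f := fun q : Ed d × Ed d => Real.cos ⟪q.1, q.2⟫) (c := 1)
        (by fun_prop : Continuous fun q : Ed d × Ed d => Real.cos ⟪q.1, q.2⟫).aestronglyMeasurable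
        (ae_of_all _ fun w => Real.abs_cos_le_one _)
      refine this.congr (ae_of_all _ fun q => ?_)
      simp only [Function.uncurry]
      ring

theorem pk_lintegral_le (d : ℕ) (a t : ℝ) (h0 : 0 < a) (h1 : a < 1) (ht : 0 < t) :
    ∫⁻ w : Ed d, ENNReal.ofReal (pk d a t w) ≤ 1 := by
  have hi := phi_integrable d a t h0 ht
  let ε : ℕ → ℝ := fun n => 1 / ((n : ℝ) + 1)
  have hε : ∀ n, 0 < ε n := fun n => by positivity
  have hεt : Tendsto ε atTop (nhds 0) := tendsto_one_div_add_atTop_nhds_zero_nat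
  have hm : Measurable (pk d a t) := pk_meas1 d a t
  have hb : ∀ w, |pk d a t w| ≤ pk d a t 0 := fun w => by
    rw [abs_of_nonneg (pk_nonneg d a t h0 h1 ht w)]
    exact (pk_good d a t h0 h1 ht 0 w (by simp)).2
  calc ∫⁻ w : Ed d, ENNReal.ofReal (pk d a t w)
      = ∫⁻ w : Ed d, liminf (fun n => ENNReal.ofReal (pk d a t w * Real.exp (-ε n * ‖w‖ ^ 2))) atTop := by
        refine lintegral_congr fun w => ?_
        symm
        apply Tendsto.liminf_eq
        refine (ENNReal.continuous_ofReal.tendsto _).comp ?_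
        have : Tendsto (fun n => Real.exp (-ε n * ‖w‖ ^ 2)) atTop (nhds 1) := by
          have h : Tendsto (fun n => -ε n * ‖w‖ ^ 2) atTop (nhds 0) := by
            simpa using hεt.neg.mul_const (‖w‖ ^ 2)
          have h2 := (Real.continuous_exp.tendsto 0).comp h; rw [Real.exp_zero] at h2; exact h2
        simpa using this.const_mul (pk d a t w)
    _ ≤ liminf (fun n => ∫⁻ w : Ed d, ENNReal.ofReal (pk d a t w * Real.exp (-ε n * ‖w‖ ^ 2))) atTop := by
        refine lintegral_liminf_le fun n => ?_
        fun_prop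
    _ ≤ 1 := by
        refine liminf_le_of_le (by isBoundedDefault) fun b hb => ?_
        obtain ⟨n, hn⟩ := hb.exists
        exact hn.trans (pk_gauss_le d a t h0 h1 ht _ (hε n))

theorem pk_integrable (d : ℕ) (a t : ℝ) (h0 : 0 < a) (h1 : a < 1) (ht : 0 < t) :
    Integrable (pk d a t) := by
  have hm : Measurable (pk d a t) := pk_meas1 d a t
  refine ⟨hm.aestronglyMeasurable, ?_⟩
  rw [hasFiniteIntegral_iff_ofReal (ae_of_all _ fun w => pk_nonneg d a t h0 h1 ht w)]
  exact lt_of_le_of_lt (pk_lintegral_le d a t h0 h1 ht) ENNReal.one_lt_top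

theorem pk_fourier (d : ℕ) (a t : ℝ) (h0 : 0 < a) (h1 : a < 1) (ht : 0 < t) (z : Ed d) :
    ∫ w : Ed d, Complex.exp ((⟪w, z⟫ : ℝ) * Complex.I) * (pk d a t w : ℂ) = phi d a t z := by
  have hi := phi_integrable d a t h0 ht
  have pi2 : (2 * π) ≠ 0 := by positivity
  let f : Ed d → ℂ := fun ξ => (phi d a t ((2 * π) • ξ) : ℂ)
  have hfc : Continuous f := by
    have := phi_cont d a t
    fun_prop
  have hfi : Integrable f := by
    have : Integrable (fun ξ : Ed d => phi d a t ((2 * π) • ξ)) := hi.comp_smul pi2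
    exact this.ofReal
  have hF : FourierTransform.fourier f = fun w => (pk d a t w : ℂ) := by
    funext w
    rw [Real.fourier_eq', pk_complex d a t h0 ht]
    have := Measure.integral_comp_smul volume (fun z : Ed d =>
      Complex.exp ((⟪-w, z⟫ : ℝ) * Complex.I) * (phi d a t z : ℂ)) (2 * π)
    have e : ∀ v : Ed d, Complex.exp (((-2 * π * ⟪v, w⟫ : ℝ) : ℂ) * Complex.I) • f v =
      Complex.exp ((⟪-w, (2 * π) • v⟫ : ℝ) * Complex.I) * (phi d a t ((2 * π) • v) : ℂ) := by
      intro v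
      simp only [f, smul_eq_mul, inner_smul_right, inner_neg_left, real_inner_comm v w]
      congr 4
      ring
    simp_rw [e]
    rw [this]
    have h2 := pk_complex d a t h0 ht (-w)
    rw [pk_neg, pk_complex d a t h0 ht w] at h2
    rw [h2, finrank_euclideanSpace, Fintype.card_fin, abs_of_nonneg (by positivity),
      Real.rpow_neg (by positivity), Real.rpow_natCast, Complex.real_smul]
  have hFi : Integrable (FourierTransform.fourier f) := by
    rw [hF]; exact (pk_integrable d a t h0 h1 ht).ofReal
  have inv := congrFun (hfc.fourierInv_fourier_eq hfi hFi) ((2 * π)⁻¹ • z)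
  rw [hF, Real.fourierInv_eq'] at inv
  simp only [f, smul_smul, mul_inv_cancel₀ pi2, one_smul] at inv
  rw [← inv]
  congr 1; ext w
  simp only [smul_eq_mul, inner_smul_right]
  congr 4
  field_simp

attribute [irreducible] pk


theorem phi_add (d : ℕ) (a s t : ℝ) (z : Ed d) : phi d a (s + t) z = phi d a s z * phi d a t z := by
  unfold phi; rw [← Real.exp_add]; congr 1; ring

theorem pk_ck_complex (d : ℕ) (a s t : ℝ) (h0 : 0 < a) (h1 : a < 1) (hs : 0 < s) (ht : 0 < t)
    (w : Ed d) : ∫ u : Ed d, (pk d a s u : ℂ) * (pk d a t (w - u) : ℂ) = pk d a (s + t) w := by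
  have hi := phi_integrable d a t h0 ht
  have hp := pk_integrable d a s h0 h1 hs
  rw [pk_complex d a (s + t) h0 (by positivity)]
  have e1 : ∀ u : Ed d, (pk d a s u : ℂ) * (pk d a t (w - u) : ℂ) =
      ((2 * π) ^ (-(d : ℝ)) : ℝ) * ∫ z : Ed d, (Complex.exp ((⟪w - u, z⟫ : ℝ) * Complex.I) *
        ((pk d a s u : ℂ) * (phi d a t z : ℂ))) := by
    intro u
    rw [pk_complex d a t h0 ht (w - u), mul_left_comm, ← integral_const_mul]
    congr 2; ext z; ring
  simp_rw [e1]
  rw [integral_const_mul, integral_integral_swap]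
  · congr 2; ext z
    have e2 : ∀ u : Ed d, Complex.exp ((⟪w - u, z⟫ : ℝ) * Complex.I) *
        ((pk d a s u : ℂ) * (phi d a t z : ℂ)) = (Complex.exp ((⟪w, z⟫ : ℝ) * Complex.I) * (phi d a t z : ℂ)) *
        (Complex.exp ((⟪u, -z⟫ : ℝ) * Complex.I) * (pk d a s u : ℂ)) := by
      intro u
      have : ((⟪w - u, z⟫ : ℝ) : ℂ) * Complex.I = (⟪w, z⟫ : ℝ) * Complex.I + (⟪u, -z⟫ : ℝ) * Complex.I := by
        rw [inner_sub_left, inner_neg_right]; push_cast; ring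
      rw [this, Complex.exp_add]; ring
    simp_rw [e2]
    rw [integral_const_mul, pk_fourier d a s h0 h1 hs, phi_add]
    have : phi d a s (-z) = phi d a s z := by simp [phi]
    rw [this]; push_cast; ring
  · have hpr : Integrable (fun q : Ed d × Ed d => (pk d a s q.1 : ℂ) * (phi d a t q.2 : ℂ)) :=
      hp.ofReal.mul_prod hi.ofReal
    have := hpr.bdd_mul (f := fun q : Ed d × Ed d => Complex.exp ((⟪w - q.1, q.2⟫ : ℝ) * Complex.I)) (c := 1)
      (by fun_prop : Continuous fun q : Ed d × Ed d => Complex.exp ((⟪w - q.1, q.2⟫ : ℝ) * Complex.I)).aestronglyMeasurable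
      (ae_of_all _ fun q => by rw [Complex.norm_exp_ofReal_mul_I])
    exact this

theorem pk_bdd (d : ℕ) (a t : ℝ) (h0 : 0 < a) (h1 : a < 1) (ht : 0 < t) (w : Ed d) :
    |pk d a t w| ≤ pk d a t 0 := by
  rw [abs_of_nonneg (pk_nonneg d a t h0 h1 ht w)]
  exact (pk_good d a t h0 h1 ht 0 w (by simp)).2

theorem pk_ck (d : ℕ) (a s t : ℝ) (h0 : 0 < a) (h1 : a < 1) (hs : 0 < s) (ht : 0 < t)
    (w : Ed d) : ∫ u : Ed d, pk d a s u * pk d a t (w - u) = pk d a (s + t) w := by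
  have := pk_ck_complex d a s t h0 h1 hs ht w
  have e : ∀ u : Ed d, (pk d a s u : ℂ) * (pk d a t (w - u) : ℂ) = ((pk d a s u * pk d a t (w - u) : ℝ) : ℂ) := by
    intro u; push_cast; rfl
  simp_rw [e] at this
  rw [integral_complex_ofReal] at this
  exact_mod_cast this

/-- ENNReal valued convolution kernel. -/
def kk (d : ℕ) (a t : ℝ) (w : Ed d) : ENNReal := ENNReal.ofReal (pk d a t w)

theorem kk_meas (d : ℕ) (a : ℝ) : Measurable (fun q : ℝ × Ed d => kk d a q.1 q.2) :=
  (pk_meas d a).ennreal_ofReal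

theorem kk_meas1 (d : ℕ) (a t : ℝ) : Measurable (kk d a t) :=
  (pk_meas1 d a t).ennreal_ofReal

@[fun_prop]
theorem kk_meas' {X : Type*} [MeasurableSpace X] (d : ℕ) (a : ℝ) {f : X → ℝ} {g : X → Ed d}
    (hf : Measurable f) (hg : Measurable g) : Measurable (fun x => kk d a (f x) (g x)) := by
  have := (kk_meas d a).comp (hf.prodMk hg)
  exact this

theorem kk_neg (d : ℕ) (a t : ℝ) (x : Ed d) : kk d a t (-x) = kk d a t x := by
  simp [kk, pk_neg]

theorem kk_ck0 (d : ℕ) (a s t : ℝ) (h0 : 0 < a) (h1 : a < 1) (hs : 0 < s) (ht : 0 < t)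
    (w : Ed d) : ∫⁻ u : Ed d, kk d a s u * kk d a t (w - u) = kk d a (s + t) w := by
  have hp := pk_integrable d a s h0 h1 hs
  have hm : Measurable (fun u : Ed d => pk d a t (w - u)) :=
    (pk_meas1 d a t).comp (measurable_const.sub measurable_id)
  have hfint : Integrable (fun u : Ed d => pk d a s u * pk d a t (w - u)) :=
    hp.mul_bdd (c := pk d a t 0) hm.aestronglyMeasurable (ae_of_all _ fun u => pk_bdd d a t h0 h1 ht _)
  unfold kk
  rw [← pk_ck d a s t h0 h1 hs ht, ofReal_integral_eq_lintegral_ofReal hfint (ae_of_all _ fun w =>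
      mul_nonneg (pk_nonneg d a s h0 h1 hs _) (pk_nonneg d a t h0 h1 ht _))]
  refine lintegral_congr fun u => ?_
  rw [ENNReal.ofReal_mul (pk_nonneg d a s h0 h1 hs _)]

theorem kk_ck (d : ℕ) (a s t : ℝ) (h0 : 0 < a) (h1 : a < 1) (hs : 0 < s) (ht : 0 < t)
    (x z : Ed d) : ∫⁻ y : Ed d, kk d a s (y - x) * kk d a t (z - y) = kk d a (s + t) (z - x) := by
  rw [← kk_ck0 d a s t h0 h1 hs ht (z - x)]
  rw [← lintegral_sub_right_eq_self (fun u => kk d a s u * kk d a t (z - x - u)) x]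
  refine lintegral_congr fun y => ?_
  congr 2
  abel

theorem kk_mono (d : ℕ) (a t : ℝ) (h0 : 0 < a) (h1 : a < 1) (ht : 0 < t) (x y : Ed d)
    (hxy : ‖x‖ ≤ ‖y‖) : kk d a t y ≤ kk d a t x :=
  ENNReal.ofReal_le_ofReal (pk_good d a t h0 h1 ht x y hxy).2

theorem kk_lintegral_le (d : ℕ) (a t : ℝ) (h0 : 0 < a) (h1 : a < 1) (ht : 0 < t) :
    ∫⁻ w : Ed d, kk d a t w ≤ 1 := pk_lintegral_le d a t h0 h1 ht



theorem mix_charFun (d : ℕ) (f : ℝ → Ed d → ℝ) (F : ℝ → Ed d → ℝ)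
    (hm : Measurable (fun q : ℝ × Ed d => f q.1 q.2))
    (hnn : ∀ s, 0 < s → ∀ y, 0 ≤ f s y)
    (hfint : ∀ s, 0 < s → Integrable (f s))
    (hF : ∀ s, 0 < s → ∀ ξ, ∫ y : Ed d, Complex.exp ((⟪y, ξ⟫ : ℝ) * Complex.I) * (f s y : ℂ) = F s ξ)
    (hFi : IntegrableOn (fun s => F s 0) (Ioi 0)) :
    Measurable (fun y : Ed d => ∫⁻ s in Ioi (0 : ℝ), ENNReal.ofReal (f s y)) ∧
    (∫⁻ y : Ed d, ∫⁻ s in Ioi (0 : ℝ), ENNReal.ofReal (f s y)) ≠ ⊤ ∧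
    ∀ ξ, charFun (volume.withDensity (fun y : Ed d => ∫⁻ s in Ioi (0 : ℝ), ENNReal.ofReal (f s y))) ξ
      = ∫ s in Ioi (0 : ℝ), (F s ξ : ℂ) := by
  set ν : Measure ℝ := volume.restrict (Ioi (0 : ℝ)) with hν
  have aeν : ∀ᵐ s ∂ν, 0 < s := ae_restrict_mem measurableSet_Ioi
  have hmeas : Measurable (fun y : Ed d => ∫⁻ s in Ioi (0 : ℝ), ENNReal.ofReal (f s y)) := by
    exact Measurable.lintegral_prod_left hm.ennreal_ofReal
  have hI : Integrable (fun q : ℝ × Ed d => f q.1 q.2) (ν.prod volume) := by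
    rw [integrable_prod_iff hm.aestronglyMeasurable]
    refine ⟨aeν.mono fun s hs => hfint s hs, ?_⟩
    refine hFi.congr (aeν.mono fun s hs => ?_)
    have h1 := hF s hs 0
    simp only [inner_zero_right, Complex.ofReal_zero, zero_mul, Complex.exp_zero, one_mul] at h1
    rw [integral_complex_ofReal] at h1
    have h1' : ∫ y, f s y = F s 0 := by exact_mod_cast h1
    simp only
    rw [← h1']
    refine integral_congr_ae (ae_of_all _ fun y => ?_)
    simp [abs_of_nonneg (hnn s hs y)]
  have hnorm : ∀ᵐ q ∂(ν.prod (volume : Measure (Ed d))), 0 ≤ f q.1 q.2 := by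
    have : ∀ᵐ q ∂(ν.prod (volume : Measure (Ed d))), 0 < q.1 := Measure.quasiMeasurePreserving_fst.ae aeν
    exact this.mono fun q hq => hnn _ hq _
  have hfin : (∫⁻ y : Ed d, ∫⁻ s in Ioi (0 : ℝ), ENNReal.ofReal (f s y)) ≠ ⊤ := by
    have := hI.lintegral_lt_top
    rw [lintegral_prod_symm _ hm.ennreal_ofReal.aemeasurable] at this
    exact this.ne
  refine ⟨hmeas, hfin, fun ξ => ?_⟩
  rw [charFun_apply, integral_withDensity_eq_integral_toReal_smul hmeas (ae_lt_top hmeas hfin)]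
  have e1 : ∀ᵐ y : Ed d, (∫⁻ s in Ioi (0 : ℝ), ENNReal.ofReal (f s y)).toReal •
      Complex.exp ((⟪y, ξ⟫ : ℝ) * Complex.I) = ∫ s in Ioi (0 : ℝ), Complex.exp ((⟪y, ξ⟫ : ℝ) * Complex.I) * (f s y : ℂ) := by
    refine ae_of_all _ fun y => ?_
    have hy : Measurable (fun s => f s y) := hm.comp (measurable_id.prodMk measurable_const)
    rw [integral_const_mul, integral_complex_ofReal, integral_eq_lintegral_of_nonneg_ae (aeν.mono fun s hs => hnn s hs y)
      hy.aestronglyMeasurable, Complex.real_smul, mul_comm]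
  rw [integral_congr_ae e1, ← integral_integral_swap]
  · refine integral_congr_ae (aeν.mono fun s hs => ?_)
    exact hF s hs ξ
  · have := hI.ofReal (𝕜 := ℂ) |>.bdd_mul (f := fun q : ℝ × Ed d => Complex.exp ((⟪q.2, ξ⟫ : ℝ) * Complex.I)) (c := 1)
      (by fun_prop : Continuous fun q : ℝ × Ed d => Complex.exp ((⟪q.2, ξ⟫ : ℝ) * Complex.I)).aestronglyMeasurable
      (ae_of_all _ fun q => by rw [Complex.norm_exp_ofReal_mul_I])
    exact this

theorem ae_eq_of_charFun (d : ℕ) (g1 g2 : Ed d → ENNReal) (h1 : Measurable g1) (h2 : Measurable g2)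
    (f1 : ∫⁻ y, g1 y ≠ ⊤) (f2 : ∫⁻ y, g2 y ≠ ⊤)
    (h : ∀ ξ, charFun (volume.withDensity g1) ξ = charFun (volume.withDensity g2) ξ) :
    g1 =ᵐ[volume] g2 := by
  rw [← withDensity_eq_iff h1.aemeasurable h2.aemeasurable f1]
  have := isFiniteMeasure_withDensity f1
  have := isFiniteMeasure_withDensity f2
  exact Measure.ext_of_charFun (funext h)

/-- Mellin transform of the kernel. -/
def UU (d : ℕ) (a σ : ℝ) (y : Ed d) : ENNReal :=
  ∫⁻ t in Ioi (0 : ℝ), ENNReal.ofReal (t ^ (σ - 1)) * kk d a t y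

/-- Bessel type integral. -/
def BI (ν r : ℝ) : ENNReal :=
  ∫⁻ u in Ioi (0 : ℝ), ENNReal.ofReal (u ^ (-ν - 1) * Real.exp (-u - r ^ 2 / (4 * u)))

/-- Constant. -/
def DD (d : ℕ) (a σ : ℝ) : ℝ := Real.Gamma σ / Real.Gamma (a * σ) * (4 * π) ^ (-((d : ℝ) / 2))

theorem DD_pos (d : ℕ) (a σ : ℝ) (h0 : 0 < a) (hσ : 0 < σ) : 0 < DD d a σ := by
  unfold DD
  have := Real.Gamma_pos_of_pos hσ
  have := Real.Gamma_pos_of_pos (mul_pos h0 hσ)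
  positivity

theorem gammaInt (σ r : ℝ) (hσ : 0 < σ) (hr : 0 < r) :
    IntegrableOn (fun t : ℝ => t ^ (σ - 1) * Real.exp (-(r * t))) (Ioi 0) := by
  by_contra h
  have h1 := integral_rpow_mul_exp_neg_mul_Ioi hσ hr
  rw [integral_undef h] at h1
  have := Real.Gamma_pos_of_pos hσ
  have : 0 < (1 / r) ^ σ * Real.Gamma σ := by positivity
  linarith

set_option maxHeartbeats 1000000 in
theorem UU_eq_BI (d : ℕ) (a σ : ℝ) (h0 : 0 < a) (h1 : a < 1) (hσ : 0 < σ) :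
    Measurable (UU d a σ) ∧
    ∀ᵐ y : Ed d, UU d a σ y = ENNReal.ofReal (DD d a σ) * BI ((d : ℝ) / 2 - a * σ) ‖y‖ := by
  have A := mix_charFun d (fun t y => t ^ (σ - 1) * pk d a t y)
    (fun t ξ => t ^ (σ - 1) * Real.exp (-((‖ξ‖ ^ 2 + 1) ^ a * t)))
    ((measurable_fst.pow_const (σ - 1)).mul (pk_meas d a))
    (fun s hs y => mul_nonneg (by positivity) (pk_nonneg d a s h0 h1 hs y))
    (fun s hs => (pk_integrable d a s h0 h1 hs).const_mul _)
    (fun s hs ξ => by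
      have := pk_fourier d a s h0 h1 hs ξ
      unfold phi at this
      push_cast
      simp_rw [mul_left_comm]
      rw [integral_const_mul, this]
      push_cast
      congr 3; ring)
    (gammaInt σ _ hσ (by positivity))
  have e4 : ∀ u : ℝ, 0 < u → ∀ y : Ed d, Real.exp (-u - ‖y‖ ^ 2 / (4 * u)) =
      Real.exp (-u) * Real.exp (-(1 / (4 * u)) * ‖y‖ ^ 2) := by
    intro u hu y
    rw [← Real.exp_add]; congr 1; field_simp; ring
  have B := mix_charFun d (fun u y => DD d a σ * (u ^ (-((d : ℝ) / 2 - a * σ) - 1) * Real.exp (-u - ‖y‖ ^ 2 / (4 * u))))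
    (fun u ξ => DD d a σ * (4 * π) ^ ((d : ℝ) / 2) * (u ^ (a * σ - 1) * Real.exp (-((‖ξ‖ ^ 2 + 1) * u))))
    (by fun_prop)
    (fun s hs y => by have := DD_pos d a σ h0 hσ; positivity)
    (fun s hs => by
      refine Integrable.const_mul (Integrable.const_mul ?_ _) _
      simp_rw [e4 s hs]
      exact (gauss_integrable _ (by positivity)).const_mul _)
    (fun s hs ξ => by
      simp_rw [e4 s hs]
      have := gauss_cexp (d := d) (1 / (4 * s)) (by positivity) ξ
      simp_rw [real_inner_comm ξ] 
      have e5 : ∀ y : Ed d, Complex.exp ((⟪ξ, y⟫ : ℝ) * Complex.I) * ((DD d a σ * (s ^ (-((d : ℝ) / 2 - a * σ) - 1) *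
          (Real.exp (-s) * Real.exp (-(1 / (4 * s)) * ‖y‖ ^ 2))) : ℝ) : ℂ) =
          ((DD d a σ * (s ^ (-((d : ℝ) / 2 - a * σ) - 1) * Real.exp (-s)) : ℝ) : ℂ) *
          (Complex.exp ((⟪ξ, y⟫ : ℝ) * Complex.I) * (Real.exp (-(1 / (4 * s)) * ‖y‖ ^ 2) : ℝ)) := by
        intro y; push_cast; ring
      simp_rw [e5]
      rw [integral_const_mul, this, ← Complex.ofReal_mul]
      congr 1
      have e6 : π / (1 / (4 * s)) = (4 * π) * s := by field_simp
      rw [e6, Real.mul_rpow (by positivity) (by positivity)]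
      have e7 : s ^ (a * σ - 1) = s ^ (-((d : ℝ) / 2 - a * σ) - 1) * s ^ ((d : ℝ) / 2) := by
        rw [← Real.rpow_add hs]; congr 1; ring
      have e8 : Real.exp (-((‖ξ‖ ^ 2 + 1) * s)) = Real.exp (-s) * Real.exp (-‖ξ‖ ^ 2 / (4 * (1 / (4 * s)))) := by
        rw [← Real.exp_add]; congr 1; field_simp; ring
      rw [e7, e8]; ring)
    (Integrable.const_mul (gammaInt (a * σ) (‖(0 : Ed d)‖ ^ 2 + 1) (by positivity) (by positivity)) _)
  obtain ⟨A1, A2, A3⟩ := A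
  obtain ⟨B1, B2, B3⟩ := B
  have key := ae_eq_of_charFun d _ _ A1 B1 A2 B2 (fun ξ => by
    rw [A3, B3, integral_complex_ofReal, integral_complex_ofReal, integral_const_mul,
      integral_rpow_mul_exp_neg_mul_Ioi hσ (by positivity), integral_rpow_mul_exp_neg_mul_Ioi (by positivity) (by positivity)]
    congr 1
    have g1 := Real.Gamma_pos_of_pos hσ
    have g2 := Real.Gamma_pos_of_pos (mul_pos h0 hσ)
    unfold DD
    rw [one_div, one_div, Real.inv_rpow (by positivity), Real.inv_rpow (by positivity), ← Real.rpow_mul (by positivity),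
      Real.rpow_neg (by positivity)]
    field_simp)
  have eU : ∀ y, UU d a σ y = ∫⁻ s in Ioi (0 : ℝ), ENNReal.ofReal (s ^ (σ - 1) * pk d a s y) := by
    intro y
    refine setLIntegral_congr_fun measurableSet_Ioi fun s hs => ?_
    have hs : 0 < s := hs
    rw [kk, ENNReal.ofReal_mul (by positivity)]
  constructor
  · rw [show UU d a σ = _ from funext eU]; exact A1
  · filter_upwards [key] with y hy
    rw [eU, hy, BI, ← lintegral_const_mul _ (by fun_prop)]
    refine lintegral_congr fun s => ?_
    rw [ENNReal.ofReal_mul (DD_pos d a σ h0 hσ).le]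


/-- Integrand. -/
def jf (ν s w : ℝ) : ℝ := w ^ (ν - 1) * Real.exp (-w - s / w)

/-- Bessel type integral, real version. -/
def JR (ν s : ℝ) : ℝ := ∫ w in Ioi (0 : ℝ), jf ν s w

theorem jf_meas (ν s : ℝ) : Measurable (jf ν s) := by unfold jf; fun_prop

theorem jf_pos (ν s w : ℝ) (hw : 0 < w) : 0 < jf ν s w := by unfold jf; positivity

theorem gammaI (ν : ℝ) (hν : 0 < ν) : IntegrableOn (fun w : ℝ => w ^ (ν - 1) * Real.exp (-w)) (Ioi 0) := by
  simpa using gammaInt ν 1 hν one_pos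

theorem gamma_eq (ν : ℝ) (hν : 0 < ν) : ∫ w in Ioi (0 : ℝ), w ^ (ν - 1) * Real.exp (-w) = Real.Gamma ν := by
  simpa using integral_rpow_mul_exp_neg_mul_Ioi hν one_pos

theorem jf_le (ν s w : ℝ) (hs : 0 ≤ s) (hw : 0 < w) : jf ν s w ≤ w ^ (ν - 1) * Real.exp (-w) := by
  unfold jf
  gcongr
  have : 0 ≤ s / w := by positivity
  linarith

theorem jf_int_pos (ν s : ℝ) (hν : 0 < ν) (hs : 0 ≤ s) : IntegrableOn (jf ν s) (Ioi 0) := by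
  refine (gammaI ν hν).mono' (jf_meas ν s).aestronglyMeasurable ?_
  refine (ae_restrict_mem measurableSet_Ioi).mono fun w hw => ?_
  rw [Real.norm_of_nonneg (jf_pos ν s w hw).le]
  exact jf_le ν s w hs hw

theorem jf_int (ν s : ℝ) (hs : 0 < s) : IntegrableOn (jf ν s) (Ioi 0) := by
  obtain ⟨k, hk⟩ := exists_nat_gt (-ν)
  have hk : 0 < ν + k := by linarith
  refine ((gammaI (ν + k) hk).const_mul (k.factorial / s ^ k)).mono' (jf_meas ν s).aestronglyMeasurable ?_
  refine (ae_restrict_mem measurableSet_Ioi).mono fun w hw => ?_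
  have hw : 0 < w := hw
  rw [Real.norm_of_nonneg (jf_pos ν s w hw).le]
  have h1 := Real.pow_div_factorial_le_exp (s / w) (by positivity) k
  have h2 : Real.exp (-(s / w)) ≤ k.factorial / (s / w) ^ k := by
    rw [Real.exp_neg, inv_le_comm₀ (Real.exp_pos _) (by positivity), inv_div]
    exact h1
  unfold jf
  rw [show -w - s / w = -w + -(s / w) by ring, Real.exp_add]
  calc w ^ (ν - 1) * (Real.exp (-w) * Real.exp (-(s / w)))
      ≤ w ^ (ν - 1) * (Real.exp (-w) * (k.factorial / (s / w) ^ k)) := by gcongr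
    _ = _ := by
      rw [show ν + k - 1 = (ν - 1) + (k : ℝ) by ring, Real.rpow_add hw, Real.rpow_natCast, div_pow]
      field_simp

theorem JR_pos' (ν s : ℝ) (h : IntegrableOn (jf ν s) (Ioi 0)) : 0 < JR ν s := by
  unfold JR
  rw [setIntegral_pos_iff_support_of_nonneg_ae ((ae_restrict_mem measurableSet_Ioi).mono fun w hw =>
    (jf_pos ν s w hw).le) h]
  have : Function.support (jf ν s) ∩ Ioi 0 = Ioi 0 := by
    apply inter_eq_right.2
    intro w hw
    exact (jf_pos ν s w hw).ne'
  rw [this]; simp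

theorem JR_pos (ν s : ℝ) (hs : 0 < s) : 0 < JR ν s := JR_pos' ν s (jf_int ν s hs)

theorem JR_le (ν s : ℝ) (hν : 0 < ν) (hs : 0 ≤ s) : JR ν s ≤ Real.Gamma ν := by
  rw [← gamma_eq ν hν]
  exact setIntegral_mono_on (jf_int_pos ν s hν hs) (gammaI ν hν) measurableSet_Ioi
    fun w hw => jf_le ν s w hs hw

theorem JR_anti (ν s s' : ℝ) (hν : 0 < ν) (hs : 0 ≤ s) (hs' : s ≤ s') : JR ν s' ≤ JR ν s := by
  refine setIntegral_mono_on (jf_int_pos ν s' hν (hs.trans hs')) (jf_int_pos ν s hν hs) measurableSet_Ioi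
    fun w hw => ?_
  have hw : 0 < w := hw
  unfold jf
  gcongr

theorem one_sub_exp_le (x θ : ℝ) (hx : 0 ≤ x) (h0 : 0 < θ) (h1 : θ ≤ 1) : 1 - Real.exp (-x) ≤ x ^ θ := by
  rcases le_total x 1 with h | h
  · have := Real.add_one_le_exp (-x)
    have h2 : x ≤ x ^ θ := by
      rcases hx.eq_or_lt with rfl | hx
      · rw [Real.zero_rpow h0.ne']
      · simpa using Real.rpow_le_rpow_of_exponent_ge hx h h1
    linarith
  · have := Real.exp_pos (-x)
    have := Real.one_le_rpow h h0.le
    linarith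

theorem JR_gap (ν s θ : ℝ) (hs : 0 ≤ s) (h0 : 0 < θ) (h1 : θ ≤ 1) (hθ : θ < ν) :
    Real.Gamma ν - JR ν s ≤ s ^ θ * Real.Gamma (ν - θ) := by
  have hν : 0 < ν := h0.trans hθ
  rw [← gamma_eq ν hν, ← gamma_eq (ν - θ) (by linarith), JR, ← integral_sub (gammaI ν hν) (jf_int_pos ν s hν hs),
    ← integral_const_mul]
  refine setIntegral_mono_on ((gammaI ν hν).sub (jf_int_pos ν s hν hs)) ((gammaI (ν - θ) (by linarith)).const_mul _)
    measurableSet_Ioi fun w hw => ?_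
  have hw : 0 < w := hw
  have h := one_sub_exp_le (s / w) θ (by positivity) h0 h1
  unfold jf
  rw [show -w - s / w = -w + -(s / w) by ring, Real.exp_add]
  calc w ^ (ν - 1) * Real.exp (-w) - w ^ (ν - 1) * (Real.exp (-w) * Real.exp (-(s / w)))
      = w ^ (ν - 1) * Real.exp (-w) * (1 - Real.exp (-(s / w))) := by ring
    _ ≤ w ^ (ν - 1) * Real.exp (-w) * (s / w) ^ θ := by gcongr
    _ = _ := by
      rw [Real.div_rpow hs hw.le, show ν - θ - 1 = (ν - 1) - θ by ring, Real.rpow_sub hw (ν - 1) θ]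
      field_simp

theorem JR_neg (ν s : ℝ) (hs : 0 < s) : JR (-ν) s = s ^ (-ν) * JR ν s := by
  have h1 := integral_comp_rpow_Ioi (jf ν s) (p := -1) (by norm_num)
  have h2 := integral_comp_mul_left_Ioi (fun x => (|(-1 : ℝ)| * x ^ ((-1 : ℝ) - 1)) • jf ν s (x ^ (-1 : ℝ))) 0 (b := s⁻¹) (by positivity)
  rw [mul_zero, h1] at h2
  have h3 : JR ν s = s⁻¹ * ∫ x in Ioi (0 : ℝ), (|(-1 : ℝ)| * (s⁻¹ * x) ^ ((-1 : ℝ) - 1)) • jf ν s ((s⁻¹ * x) ^ (-1 : ℝ)) := by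
    rw [h2, smul_eq_mul, inv_inv, ← mul_assoc, inv_mul_cancel₀ hs.ne', one_mul]; rfl
  rw [h3, ← integral_const_mul, ← integral_const_mul]
  unfold JR
  refine setIntegral_congr_fun measurableSet_Ioi fun u hu => ?_
  have hu : 0 < u := hu
  simp only [jf, smul_eq_mul, abs_neg, abs_one, one_mul]
  have e1 : (s⁻¹ * u) ^ (-1 : ℝ) = s / u := by rw [Real.rpow_neg_one]; field_simp
  have e2 : (s⁻¹ * u) ^ ((-1 : ℝ) - 1) = (s / u) ^ (2 : ℝ) := by
    rw [show (-1 : ℝ) - 1 = (-1) * 2 by norm_num, Real.rpow_mul (by positivity), e1]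
  rw [e1, e2, show s / (s / u) = u by field_simp, show -(s / u) - u = -u - s / u by ring]
  have e3 : (s / u) ^ (2 : ℝ) * (s / u) ^ (ν - 1) = s * (s ^ ν * u ^ (-ν - 1)) := by
    rw [← Real.rpow_add (by positivity), Real.div_rpow hs.le hu.le, show 2 + (ν - 1) = ν + 1 by ring,
      show -ν - 1 = -(ν + 1) by ring, Real.rpow_neg hu.le, Real.rpow_add hs, Real.rpow_one]
    field_simp
  have e4 : s ^ (-ν) * s ^ ν = 1 := by rw [← Real.rpow_add hs]; simp
  calc u ^ (-ν - 1) * Real.exp (-u - s / u) = (s⁻¹ * s) * (s ^ (-ν) * s ^ ν) * (u ^ (-ν - 1) * Real.exp (-u - s / u)) := by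
        rw [e4, inv_mul_cancel₀ hs.ne']; ring
    _ = s ^ (-ν) * s⁻¹ * ((s * (s ^ ν * u ^ (-ν - 1))) * Real.exp (-u - s / u)) := by ring
    _ = _ := by rw [← e3]; ring

theorem JR_far (ν s0 : ℝ) (hs0 : 0 < s0) : ∃ C, 0 < C ∧ ∀ b s, 0 ≤ b → b ≤ 1 → s0 ≤ s →
    JR (-ν - b) s ≤ C * JR (-ν) s := by
  set A : ℝ := 2 ^ (ν + 1) * (Real.exp 1 * (2 / s0)) with hA
  have hA0 : 0 < A := by positivity
  refine ⟨1 + A / 2, by positivity, fun b s hb0 hb1 hs => ?_⟩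
  have hs1 : 0 < s := by linarith
  have hF := jf_int (-ν) s hs1
  have hF2 : IntegrableOn (fun u => jf (-ν) s (2 * u)) (Ioi 0) := by
    rw [integrableOn_Ioi_comp_mul_left_iff _ _ two_pos]; simpa using hF
  have e : (1 + A / 2) * JR (-ν) s = ∫ u in Ioi (0 : ℝ), (jf (-ν) s u + A * jf (-ν) s (2 * u)) := by
    rw [integral_add hF (hF2.const_mul _), integral_const_mul, integral_comp_mul_left_Ioi _ _ two_pos]
    simp only [JR, mul_zero, smul_eq_mul]; ring
  rw [e]
  refine setIntegral_mono_on (jf_int _ s hs1) (hF.add (hF2.const_mul _)) measurableSet_Ioi fun u hu => ?_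
  have hu : 0 < u := hu
  have p1 := jf_pos (-ν) s u hu
  have p2 := jf_pos (-ν) s (2 * u) (by positivity)
  have e0 : jf (-ν - b) s u = u ^ (-b) * jf (-ν) s u := by
    unfold jf
    rw [show -ν - b - 1 = -b + (-ν - 1) by ring, Real.rpow_add hu]; ring
  rcases le_total 1 u with h | h
  · have : u ^ (-b) ≤ 1 := Real.rpow_le_one_of_one_le_of_nonpos h (by linarith)
    calc jf (-ν - b) s u = u ^ (-b) * jf (-ν) s u := e0
      _ ≤ 1 * jf (-ν) s u := by gcongr
      _ ≤ _ := by nlinarith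
  · have h1 : u ^ (-b) ≤ u⁻¹ := by
      rw [← Real.rpow_neg_one]
      exact Real.rpow_le_rpow_of_exponent_ge hu h (by linarith)
    have h2 : jf (-ν) s u = 2 ^ (ν + 1) * (Real.exp (u) * Real.exp (-(s / (2 * u)))) * jf (-ν) s (2 * u) := by
      unfold jf
      rw [Real.mul_rpow (by norm_num) hu.le, show -ν - 1 = -(ν + 1) by ring, Real.rpow_neg (x := 2) (by norm_num)]
      have : Real.exp (-u - s / u) = Real.exp u * Real.exp (-(s / (2 * u))) * Real.exp (-(2 * u) - s / (2 * u)) := by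
        rw [← Real.exp_add, ← Real.exp_add]; congr 1; field_simp; ring
      rw [this]; field_simp
    have h3 : u⁻¹ * Real.exp (-(s / (2 * u))) ≤ 2 / s0 := by
      have := Real.add_one_le_exp (s0 / (2 * u))
      have h4 : Real.exp (-(s / (2 * u))) ≤ Real.exp (-(s0 / (2 * u))) := by gcongr
      have h5 : Real.exp (-(s0 / (2 * u))) ≤ (s0 / (2 * u))⁻¹ := by
        rw [Real.exp_neg]; gcongr; linarith
      calc u⁻¹ * Real.exp (-(s / (2 * u))) ≤ u⁻¹ * (s0 / (2 * u))⁻¹ := by gcongr; exact h4.trans h5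
        _ = _ := by field_simp
    calc jf (-ν - b) s u = u ^ (-b) * (2 ^ (ν + 1) * (Real.exp (u) * Real.exp (-(s / (2 * u)))) * jf (-ν) s (2 * u)) := by
          rw [e0, h2]
      _ ≤ u⁻¹ * (2 ^ (ν + 1) * (Real.exp 1 * Real.exp (-(s / (2 * u)))) * jf (-ν) s (2 * u)) := by gcongr
      _ = 2 ^ (ν + 1) * (Real.exp 1 * (u⁻¹ * Real.exp (-(s / (2 * u))))) * jf (-ν) s (2 * u) := by ring
      _ ≤ A * jf (-ν) s (2 * u) := by rw [hA]; gcongr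
      _ ≤ _ := by linarith

theorem BI_eq (ν r : ℝ) (hr : r ≠ 0) : BI ν r = ENNReal.ofReal (JR (-ν) (r ^ 2 / 4)) := by
  unfold JR
  rw [ofReal_integral_eq_lintegral_ofReal (jf_int _ _ (by positivity)) ((ae_restrict_mem measurableSet_Ioi).mono fun w hw =>
    (jf_pos _ _ w hw).le)]
  unfold BI jf
  refine lintegral_congr fun u => ?_
  rw [div_div]

theorem besselK_eq (ν r : ℝ) : besselK ν r = (1 / 2) * (r / 2) ^ ν * JR (-ν) (r ^ 2 / 4) := by
  unfold besselK JR jf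
  congr 2
  ext u
  rw [div_div]


/-- Product form of the Hardy constant. -/
def kap (a S s : ℝ) : ℝ :=
  Real.Gamma (s + a) * Real.Gamma (S - s + a) / (Real.Gamma s * Real.Gamma (S - s))

/-- Factor. -/
def kT (a S s : ℝ) (j : ℕ) : ℝ := (s + j) * (S - s + j) / ((s + a + j) * (S - s + a + j))

theorem kT_pos (a S s : ℝ) (j : ℕ) (ha : 0 < a) (h0 : 0 < s) (h1 : s < S) : 0 < kT a S s j := by
  have : 0 < S - s := by linarith
  unfold kT; positivity

theorem kT_lt (a S s1 s2 : ℝ) (j : ℕ) (ha : 0 < a) (h0 : 0 < s1) (h1 : s1 < s2) (h2 : s2 ≤ S / 2) :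
    kT a S s1 j < kT a S s2 j := by
  have h3 : 0 < S - s2 := by linarith
  have h4 : 0 < S - s1 := by linarith
  have h5 : 0 < s2 := by linarith
  have hj : (0 : ℝ) ≤ j := by positivity
  unfold kT
  have hX : (s1 + j) * (S - s1 + j) < (s2 + j) * (S - s2 + j) := by nlinarith
  have e : ∀ s, (s + a + j) * (S - s + a + j) = (s + j) * (S - s + j) + (a * (S + 2 * j) + a ^ 2) := by
    intro s; ring
  rw [e, e]
  have c0 : 0 < a * (S + 2 * j) + a ^ 2 := by
    have : 0 < S := by linarith
    positivity
  have p1 : 0 < (s1 + j) * (S - s1 + j) := by positivity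
  rw [div_lt_div_iff₀ (by linarith) (by linarith)]
  nlinarith

theorem kap_seq (a S s : ℝ) (n : ℕ) (hn : n ≠ 0) (h0 : 0 < s) (h1 : s < S) :
    Real.GammaSeq (s + a) n * Real.GammaSeq (S - s + a) n / (Real.GammaSeq s n * Real.GammaSeq (S - s) n)
      = (n : ℝ) ^ a * (n : ℝ) ^ a * ∏ j ∈ Finset.range (n + 1), kT a S s j := by
  have hn' : (0 : ℝ) < n := by positivity
  have h3 : 0 < S - s := by linarith
  have P1 : ∏ j ∈ Finset.range (n + 1), (s + (j : ℝ)) ≠ 0 := Finset.prod_ne_zero_iff.2 fun j _ => by positivity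
  have P2 : ∏ j ∈ Finset.range (n + 1), (S - s + (j : ℝ)) ≠ 0 := Finset.prod_ne_zero_iff.2 fun j _ => by positivity
  unfold kT Real.GammaSeq
  rw [Finset.prod_div_distrib, Finset.prod_mul_distrib, Finset.prod_mul_distrib, Real.rpow_add hn', Real.rpow_add hn']
  have q1 : (n : ℝ) ^ s ≠ 0 := by positivity
  have q2 : (n : ℝ) ^ (S - s) ≠ 0 := by positivity
  have q3 : (n.factorial : ℝ) ≠ 0 := by positivity
  field_simp

theorem kap_lt (a S s1 s2 : ℝ) (ha : 0 < a) (h0 : 0 < s1) (h1 : s1 < s2) (h2 : s2 ≤ S / 2) :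
    kap a S s1 < kap a S s2 := by
  have T : ∀ s, 0 < s → s < S → Tendsto (fun n : ℕ => (n : ℝ) ^ a * (n : ℝ) ^ a * ∏ j ∈ Finset.range (n + 1), kT a S s j)
      atTop (nhds (kap a S s)) := by
    intro s hs hs'
    have h3 : 0 < S - s := by linarith
    have g1 := (Real.Gamma_pos_of_pos hs).ne'
    have g2 := (Real.Gamma_pos_of_pos h3).ne'
    have := ((Real.GammaSeq_tendsto_Gamma (s + a)).mul (Real.GammaSeq_tendsto_Gamma (S - s + a))).div
      ((Real.GammaSeq_tendsto_Gamma s).mul (Real.GammaSeq_tendsto_Gamma (S - s))) (mul_ne_zero g1 g2)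
    refine this.congr' ?_
    filter_upwards [eventually_ne_atTop 0] with n hn
    exact kap_seq a S s n hn hs hs'
  have t1 := T s1 h0 (by linarith)
  have t2 := T s2 (by linarith) (by linarith)
  set R := kT a S s1 0 / kT a S s2 0 with hR
  have k1 := kT_pos a S s1 0 ha h0 (by linarith)
  have k2 := kT_pos a S s2 0 ha (by linarith) (by linarith)
  have hR1 : R < 1 := by rw [hR, div_lt_one k2]; exact kT_lt a S s1 s2 0 ha h0 h1 h2
  have le : kap a S s1 ≤ R * kap a S s2 := by
    refine le_of_tendsto_of_tendsto' t1 (t2.const_mul R) fun n => ?_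
    have : ∏ j ∈ Finset.range (n + 1), kT a S s1 j ≤ R * ∏ j ∈ Finset.range (n + 1), kT a S s2 j := by
      rw [Finset.prod_range_succ', Finset.prod_range_succ']
      have e : R * ((∏ k ∈ Finset.range n, kT a S s2 (k + 1)) * kT a S s2 0) =
          (∏ k ∈ Finset.range n, kT a S s2 (k + 1)) * kT a S s1 0 := by
        rw [hR]; field_simp
      rw [e]
      gcongr with j hj
      · intro j hj; exact (kT_pos a S s1 _ ha h0 (by linarith)).le
      · exact (kT_lt a S s1 s2 _ ha h0 h1 h2).le
    calc _ ≤ (n : ℝ) ^ a * (n : ℝ) ^ a * (R * ∏ j ∈ Finset.range (n + 1), kT a S s2 j) := by gcongr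
      _ = _ := by ring
  have pos : 0 < kap a S s2 := by
    have := Real.Gamma_pos_of_pos (show 0 < s2 by linarith)
    have := Real.Gamma_pos_of_pos (show 0 < S - s2 by linarith)
    have := Real.Gamma_pos_of_pos (show 0 < S - s2 + a by linarith)
    have := Real.Gamma_pos_of_pos (show 0 < s2 + a by linarith)
    unfold kap; positivity
  nlinarith


/-- Gamma quotient. -/
def BB (a S b : ℝ) : ℝ := Real.Gamma (S - b + a) / Real.Gamma (S - b)

theorem BB_pos (a S b : ℝ) (ha : 0 < a) (hb : b < S) : 0 < BB a S b := by
  have := Real.Gamma_pos_of_pos (show 0 < S - b by linarith)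
  have := Real.Gamma_pos_of_pos (show 0 < S - b + a by linarith)
  unfold BB; positivity

/-- Radial potential as a function of `s = r^2/4`. -/
def Qr (a S D s : ℝ) : ℝ := BB a S D * JR (-(D + a)) s / JR (-D) s

theorem Qr_pos (a S D s : ℝ) (ha : 0 < a) (hb : D < S) (hs : 0 < s) : 0 < Qr a S D s := by
  have := BB_pos a S D ha hb
  have := JR_pos (-(D + a)) s hs
  have := JR_pos (-D) s hs
  unfold Qr; positivity

theorem BB_kap (a S b : ℝ) (hb : 0 < b) :
    BB a S b * Real.Gamma (b + a) = kap a S b * Real.Gamma b := by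
  have := Real.Gamma_pos_of_pos hb
  unfold BB kap
  field_simp

theorem Qr_eq (a S D s : ℝ) (hs : 0 < s) :
    Qr a S D s = s ^ (-a) * (BB a S D * JR (D + a) s / JR D s) := by
  unfold Qr
  rw [JR_neg _ _ hs, JR_neg _ _ hs, show -(D + a) = -a + -D by ring, Real.rpow_add hs]
  have : s ^ (-D) ≠ 0 := by positivity
  have := (JR_pos D s hs).ne'
  field_simp

theorem Qr_le (a S D s : ℝ) (ha : 0 < a) (hD : 0 < D) (hb : D < S) (hs : 0 < s) (hs1 : s ≤ 1) :
    Qr a S D s ≤ BB a S D * Real.Gamma (D + a) / JR D 1 * s ^ (-a) := by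
  rw [Qr_eq a S D s hs, mul_comm]
  have := BB_pos a S D ha hb
  have := JR_pos D 1 one_pos
  have := JR_le (D + a) s (by positivity) hs.le
  have := JR_anti D s 1 hD hs.le hs1
  have := Real.Gamma_pos_of_pos (show 0 < D + a by positivity)
  gcongr

/-- The key near-zero estimate. -/
theorem near_key (a S D : ℝ) (ha : 0 < a) (hD : 0 < D) (hDS : D ≤ S / 2) :
    ∃ θ C : ℝ, 0 < θ ∧ 0 < C ∧ ∀ b s : ℝ, D / 2 ≤ b → b ≤ D → 0 < s → s ≤ 1 →
      s ^ (-(b + a)) * (Real.Gamma b * (kap a S D - kap a S b) - C * s ^ θ) ≤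
        Qr a S D s * JR (-b) s - BB a S b * JR (-(b + a)) s := by
  set θ := min 1 (D / 4) with hθ
  have hθ0 : 0 < θ := lt_min one_pos (by positivity)
  have hθ1 : θ ≤ 1 := min_le_left _ _
  have hθ2 : θ ≤ D / 4 := min_le_right _ _
  obtain ⟨M, hM⟩ := (isCompact_Icc (a := D / 4) (b := D)).exists_bound_of_continuousOn (f := Real.Gamma)
    (fun x hx => (Real.differentiableAt_Gamma (fun m => by
      have : 0 < x := by linarith [hx.1]
      have : (0 : ℝ) ≤ m := by positivity
      linarith)).continuousAt.continuousWithinAt)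
  have hM' : ∀ x, D / 4 ≤ x → x ≤ D → Real.Gamma x ≤ M := fun x h1 h2 =>
    (le_abs_self _).trans (hM x ⟨h1, h2⟩)
  have hB := BB_pos a S D ha (by linarith)
  have gD := Real.Gamma_pos_of_pos hD
  have gDa := Real.Gamma_pos_of_pos (show 0 < D + a by positivity)
  have gx := Real.Gamma_pos_of_pos (show 0 < D + a - θ by linarith)
  have M0 : 0 < M := gD.trans_le (hM' D (by linarith) le_rfl)
  refine ⟨θ, BB a S D / Real.Gamma D * (Real.Gamma (D + a - θ) * M + Real.Gamma (D + a) * M), hθ0, by positivity, ?_⟩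
  intro b s hb1 hb2 hs hs1
  have b0 : 0 < b := by linarith
  have gb := Real.Gamma_pos_of_pos b0
  have U1 := JR_le (D + a) s (by positivity) hs.le
  have U2 := JR_gap (D + a) s θ hs.le hθ0 hθ1 (by linarith)
  have V1 := JR_le b s b0 hs.le
  have V2 := JR_gap b s θ hs.le hθ0 hθ1 (by linarith)
  have U0 := JR_pos (D + a) s hs
  have V0 := JR_pos b s hs
  have W0 := JR_pos D s hs
  have W1 := JR_le D s hD hs.le
  have Z1 := JR_le (b + a) s (by positivity) hs.le
  have st : 0 < s ^ θ := by positivity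
  have m1 := hM' b (by linarith) hb2
  have m2 := hM' (b - θ) (by linarith) (by linarith)
  have Bb := BB_pos a S b ha (by linarith)
  rw [Qr_eq a S D s hs, JR_neg b _ hs, JR_neg (b + a) _ hs]
  have e : s ^ (-a) * (BB a S D * JR (D + a) s / JR D s) * (s ^ (-b) * JR b s) - BB a S b * (s ^ (-(b + a)) * JR (b + a) s)
      = s ^ (-(b + a)) * (BB a S D * JR (D + a) s / JR D s * JR b s - BB a S b * JR (b + a) s) := by
    rw [show -(b + a) = -a + -b by ring, Real.rpow_add hs]; ring
  rw [e]
  refine mul_le_mul_of_nonneg_left ?_ (by positivity)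
  have f1 : BB a S b * JR (b + a) s ≤ kap a S b * Real.Gamma b := by
    rw [← BB_kap a S b b0]; gcongr
  have f2 : BB a S D / Real.Gamma D * (JR (D + a) s * JR b s) ≤ BB a S D * JR (D + a) s / JR D s * JR b s := by
    calc _ ≤ BB a S D / JR D s * (JR (D + a) s * JR b s) := by gcongr
      _ = _ := by ring
  have f3 : Real.Gamma (D + a) * Real.Gamma b - s ^ θ * (Real.Gamma (D + a - θ) * M + Real.Gamma (D + a) * M) ≤
      JR (D + a) s * JR b s := by
    have g1 : Real.Gamma (D + a) * (Real.Gamma b - JR b s) ≤ Real.Gamma (D + a) * (s ^ θ * M) := by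
      refine mul_le_mul_of_nonneg_left (V2.trans ?_) gDa.le
      gcongr
    have g2 : JR b s * (Real.Gamma (D + a) - JR (D + a) s) ≤ M * (s ^ θ * Real.Gamma (D + a - θ)) := by
      refine mul_le_mul (V1.trans m1) U2 (by linarith) M0.le
    nlinarith
  have f4 : BB a S D / Real.Gamma D * (Real.Gamma (D + a) * Real.Gamma b) = Real.Gamma b * kap a S D := by
    have := BB_kap a S D hD
    field_simp
    nlinarith
  have f5 := mul_le_mul_of_nonneg_left f3 (show 0 ≤ BB a S D / Real.Gamma D by positivity)
  rw [mul_sub, f4] at f5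
  have f6 : Real.Gamma b * (kap a S D - kap a S b) = Real.Gamma b * kap a S D - kap a S b * Real.Gamma b := by ring
  rw [f6]
  linarith [f5, f2, f1, mul_left_comm (BB a S D / Real.Gamma D) (s ^ θ) (Real.Gamma (D + a - θ) * M + Real.Gamma (D + a) * M),
    mul_comm (s ^ θ) (BB a S D / Real.Gamma D * (Real.Gamma (D + a - θ) * M + Real.Gamma (D + a) * M))]

/-- constant comparison -/
theorem far_key (a D s0 : ℝ) (ha : 0 < a) (ha1 : a < 1) (hs0 : 0 < s0) :
    ∃ C : ℝ, 0 < C ∧ ∀ ε s : ℝ, 0 ≤ ε → ε ≤ 1 → s0 ≤ s →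
      JR (-(D - a * ε + a)) s ≤ C * JR (-D) s := by
  obtain ⟨C, hC, h⟩ := JR_far D s0 hs0
  refine ⟨C, hC, fun ε s h0 h1 hs => ?_⟩
  have := h (a - a * ε) s (by nlinarith) (by nlinarith) hs
  rwa [show -(D - a * ε + a) = -D - (a - a * ε) by ring]

/-- real form of estimate (i), near zero -/
theorem near_i (a S D b l A C0 : ℝ) (ha : 0 < a) (hD : 0 < D) (hDS : D ≤ S / 2)
    (hb1 : D / 2 ≤ b) (hb2 : b < D) (hl : 0 < l) (hA : 0 < A) (hC0 : 0 < C0) :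
    ∃ c s0 : ℝ, 0 < c ∧ 0 < s0 ∧ ∀ s : ℝ, 0 < s → s < s0 →
      c * JR (-(b + a)) s + l * (A * (BB a S b * JR (-(b + a)) s)) + Qr a S D s * C0 ≤
        l * (A * (Qr a S D s * JR (-b) s)) := by
  obtain ⟨θ, C, hθ, hC, key⟩ := near_key a S D ha hD hDS
  have b0 : 0 < b := by linarith
  have gb := Real.Gamma_pos_of_pos b0
  have gba := Real.Gamma_pos_of_pos (show 0 < b + a by positivity)
  have hk := kap_lt a S b D ha b0 hb2 hDS
  set Δ := Real.Gamma b * (kap a S D - kap a S b) with hΔ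
  have hΔ0 : 0 < Δ := mul_pos gb (by linarith)
  have hB := BB_pos a S D ha (by linarith)
  have gDa := Real.Gamma_pos_of_pos (show 0 < D + a by positivity)
  have JD := JR_pos D 1 one_pos
  set E := BB a S D * Real.Gamma (D + a) / JR D 1 with hE
  have hE0 : 0 < E := by positivity
  have T : Tendsto (fun s : ℝ => l * A * C * s ^ θ + E * C0 * s ^ b) (nhds 0) (nhds (l * A * C * 0 ^ θ + E * C0 * 0 ^ b)) :=
    (((Real.continuousAt_rpow_const 0 θ (Or.inr hθ.le)).tendsto).const_mul _).add
      (((Real.continuousAt_rpow_const 0 b (Or.inr b0.le)).tendsto).const_mul _)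
  rw [Real.zero_rpow hθ.ne', Real.zero_rpow b0.ne', mul_zero, mul_zero, add_zero] at T
  have ev := T.eventually (gt_mem_nhds (show 0 < l * A * Δ / 2 by positivity))
  obtain ⟨s1, hs1, hball⟩ := Metric.eventually_nhds_iff.1 ev
  refine ⟨l * A * Δ / 2 / Real.Gamma (b + a), min s1 1, by positivity, lt_min hs1 one_pos, fun s hs hss => ?_⟩
  have hs1' : s ≤ 1 := hss.le.trans (min_le_right _ _)
  have hsm := hball (y := s) (by
    rw [Real.dist_eq, sub_zero, abs_of_pos hs]; exact hss.trans_le (min_le_left _ _))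
  have k := key b s hb1 hb2.le hs hs1'
  have q := Qr_le a S D s ha hD (by linarith) hs hs1'
  rw [← hE] at q
  set P := s ^ (-(b + a)) with hP
  have hP0 : 0 < P := by positivity
  have w : JR (-(b + a)) s ≤ P * Real.Gamma (b + a) := by
    rw [JR_neg _ _ hs]; gcongr; exact JR_le _ _ (by positivity) hs.le
  have sa : s ^ (-a) = P * s ^ b := by rw [hP, ← Real.rpow_add hs]; congr 1; ring
  rw [sa] at q
  have k2 := mul_le_mul_of_nonneg_left k (show 0 ≤ l * A by positivity)
  have w2 : l * A * Δ / 2 / Real.Gamma (b + a) * JR (-(b + a)) s ≤ l * A * Δ / 2 * P := by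
    calc _ ≤ l * A * Δ / 2 / Real.Gamma (b + a) * (P * Real.Gamma (b + a)) := by gcongr
      _ = _ := by field_simp
  have q2 : Qr a S D s * C0 ≤ P * (E * C0 * s ^ b) := by
    calc _ ≤ E * (P * s ^ b) * C0 := by gcongr
      _ = _ := by ring
  have hsm2 := mul_le_mul_of_nonneg_left hsm.le hP0.le
  linarith

/-- real form of estimate (ii), near zero -/
theorem near_ii (a S D C0 M1 : ℝ) (ha : 0 < a) (hD : 0 < D) (hDS : D ≤ S / 2)
    (hC0 : 0 < C0) (hM1 : 0 < M1) :
    ∃ ε0 : ℝ, 0 < ε0 ∧ ε0 ≤ 1 ∧ a * ε0 ≤ D / 2 ∧ ∃ C : ℝ, 0 < C ∧ ∀ ε l A s : ℝ, 0 < ε → ε ≤ ε0 → 0 < l → l ≤ 1 →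
      0 < A → A ≤ M1 → 0 < s → s ≤ 1 →
      l * (A * (BB a S (D - a * ε) * JR (-(D - a * ε + a)) s)) + Qr a S D s * C0 ≤
        l * (A * (Qr a S D s * JR (-(D - a * ε)) s)) + C * JR (-(D - a * ε0 + a)) s := by
  obtain ⟨θ, C, hθ, hC, key⟩ := near_key a S D ha hD hDS
  set ε0 := min 1 (min (D / 2) θ / a) with hε0
  have e0 : 0 < ε0 := lt_min one_pos (by positivity)
  have e1 : a * ε0 ≤ min (D / 2) θ := by
    have : ε0 ≤ min (D / 2) θ / a := min_le_right _ _
    rw [le_div_iff₀ ha] at this; linarith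
  have e2 : a * ε0 ≤ D / 2 := e1.trans (min_le_left _ _)
  have e3 : a * ε0 ≤ θ := e1.trans (min_le_right _ _)
  set b0 := D - a * ε0 with hb0
  have b00 : 0 < b0 := by linarith
  have J0 := JR_pos (b0 + a) 1 one_pos
  have hB := BB_pos a S D ha (by linarith)
  have gDa := Real.Gamma_pos_of_pos (show 0 < D + a by positivity)
  have JD := JR_pos D 1 one_pos
  set E := BB a S D * Real.Gamma (D + a) / JR D 1 with hE
  have hE0 : 0 < E := by positivity
  refine ⟨ε0, e0, min_le_left _ _, e2, (M1 * C + E * C0) / JR (b0 + a) 1, by positivity, ?_⟩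
  intro ε l A s hε hεε hl hl1 hA hA1 hs hs1
  set b := D - a * ε with hb
  have hbb : b0 ≤ b := by rw [hb, hb0]; nlinarith
  have hbD : b < D := by rw [hb]; nlinarith
  have k := key b s (by linarith) hbD.le hs hs1
  have hk := kap_lt a S b D ha (by linarith) hbD hDS
  have gb := Real.Gamma_pos_of_pos (show 0 < b by linarith)
  have q := Qr_le a S D s ha hD (by linarith) hs hs1
  rw [← hE] at q
  set P := s ^ (-(b0 + a)) with hP
  have hP0 : 0 < P := by positivity
  have k1 : -(P * C) ≤ Qr a S D s * JR (-b) s - BB a S b * JR (-(b + a)) s := by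
    refine le_trans ?_ k
    have p1 : s ^ (-(b + a)) * s ^ θ ≤ P := by
      rw [hP, ← Real.rpow_add hs]
      exact Real.rpow_le_rpow_of_exponent_ge hs hs1 (by linarith)
    have p2 : 0 ≤ s ^ (-(b + a)) * (Real.Gamma b * (kap a S D - kap a S b)) :=
      mul_nonneg (by positivity) (mul_nonneg gb.le (by linarith))
    nlinarith
  have k2 := mul_le_mul_of_nonneg_left k1 (show 0 ≤ l * A by positivity)
  have k3 : l * A * (P * C) ≤ M1 * (P * C) := by
    refine mul_le_mul_of_nonneg_right ?_ (by positivity)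
    calc l * A ≤ 1 * M1 := by gcongr
      _ = M1 := one_mul _
  have q2 : Qr a S D s * C0 ≤ P * (E * C0) := by
    have : s ^ (-a) ≤ P := by
      rw [hP]; exact Real.rpow_le_rpow_of_exponent_ge hs hs1 (by linarith)
    calc _ ≤ E * P * C0 := by gcongr; exact q.trans (by gcongr)
      _ = _ := by ring
  have w : P * (M1 * C + E * C0) ≤ (M1 * C + E * C0) / JR (b0 + a) 1 * JR (-(b0 + a)) s := by
    rw [JR_neg _ _ hs, ← hP]
    have := JR_anti (b0 + a) s 1 (by positivity) hs.le hs1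
    calc P * (M1 * C + E * C0) = (M1 * C + E * C0) / JR (b0 + a) 1 * (P * JR (b0 + a) 1) := by field_simp
      _ ≤ _ := by gcongr
  linarith


/-- Superposition of kernels. -/
def LL (d : ℕ) (a : ℝ) (f : ℝ → ENNReal) (y : Ed d) : ENNReal :=
  ∫⁻ u in Ioi (0 : ℝ), f u * kk d a u y

/-- Primitive. -/
def prim (f : ℝ → ENNReal) (u : ℝ) : ENNReal := ∫⁻ w in Ioo (0 : ℝ) u, f w

/-- Approximating densities. -/
def fe (γ ε : ℝ) (w : ℝ) : ENNReal := ENNReal.ofReal (γ * w ^ (γ - 1) * (min w 1) ^ ε)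

theorem fe_meas (γ ε : ℝ) : Measurable (fe γ ε) := by unfold fe; fun_prop

theorem prim_meas (f : ℝ → ENNReal) : Measurable (prim f) := by
  have : Monotone (prim f) := fun u v huv => lintegral_mono_set (Ioo_subset_Ioo_right huv)
  exact this.measurable

theorem LL_meas (d : ℕ) (a : ℝ) (f : ℝ → ENNReal) (hf : Measurable f) : Measurable (LL d a f) := by
  unfold LL
  have h : Measurable (fun q : ℝ × Ed d => f q.1 * kk d a q.1 q.2) :=
    (hf.comp measurable_fst).mul (kk_meas d a)
  exact h.lintegral_prod_left

theorem LL_mono (d : ℕ) (a : ℝ) (f g : ℝ → ENNReal) (h : ∀ u, 0 < u → f u ≤ g u) (y : Ed d) :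
    LL d a f y ≤ LL d a g y := by
  refine setLIntegral_mono' measurableSet_Ioi fun u hu => ?_
  gcongr
  exact h u hu

theorem LL_congr (d : ℕ) (a : ℝ) (f g : ℝ → ENNReal) (h : ∀ u, 0 < u → f u = g u) (y : Ed d) :
    LL d a f y = LL d a g y := by
  refine setLIntegral_congr_fun measurableSet_Ioi fun u hu => ?_
  show f u * _ = g u * _
  rw [h u hu]

theorem LL_const_mul (d : ℕ) (a : ℝ) (c : ENNReal) (f : ℝ → ENNReal) (hf : Measurable f) (y : Ed d) :
    LL d a (fun u => c * f u) y = c * LL d a f y := by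
  unfold LL
  rw [← lintegral_const_mul _ (by fun_prop)]
  simp_rw [mul_assoc]

theorem LL_add (d : ℕ) (a : ℝ) (f g : ℝ → ENNReal) (hf : Measurable f) (y : Ed d) :
    LL d a (fun u => f u + g u) y = LL d a f y + LL d a g y := by
  unfold LL
  rw [← lintegral_add_left (by fun_prop)]
  simp_rw [add_mul]

theorem UU_eq_LL (d : ℕ) (a σ : ℝ) (y : Ed d) : UU d a σ y = LL d a (fun t => ENNReal.ofReal (t ^ (σ - 1))) y := rfl

theorem prim_rpow (p u : ℝ) (hp : 0 < p) (hu : 0 < u) :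
    ∫⁻ w in Ioo (0 : ℝ) u, ENNReal.ofReal (p * w ^ (p - 1)) = ENNReal.ofReal (u ^ p) := by
  have hi : IntegrableOn (fun w : ℝ => p * w ^ (p - 1)) (Ioo 0 u) := by
    have := (intervalIntegral.intervalIntegrable_rpow' (a := 0) (b := u) (r := p - 1) (by linarith)).1
    exact (this.mono_set Ioo_subset_Ioc_self).const_mul p
  rw [← ofReal_integral_eq_lintegral_ofReal hi]
  · rw [← integral_Ioc_eq_integral_Ioo, ← intervalIntegral.integral_of_le hu.le, intervalIntegral.integral_const_mul,
      integral_rpow (Or.inl (by linarith))]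
    congr 1
    rw [sub_add_cancel, Real.zero_rpow hp.ne']
    field_simp
    ring
  · refine (ae_restrict_mem measurableSet_Ioo).mono fun w hw => ?_
    have : 0 < w := hw.1
    simp only [Pi.zero_apply]
    positivity

theorem fe_le (γ ε w : ℝ) (hγ : 0 < γ) (hε : 0 ≤ ε) (hw : 0 < w) :
    fe γ ε w ≤ ENNReal.ofReal γ * ENNReal.ofReal (w ^ (γ + ε - 1)) := by
  unfold fe
  rw [← ENNReal.ofReal_mul hγ.le, mul_assoc]
  apply ENNReal.ofReal_le_ofReal
  rw [show γ + ε - 1 = (γ - 1) + ε by ring, Real.rpow_add hw]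
  gcongr
  exact min_le_left _ _

theorem fe_zero (γ w : ℝ) (hγ : 0 < γ) : fe γ 0 w = ENNReal.ofReal γ * ENNReal.ofReal (w ^ (γ - 1)) := by
  unfold fe
  rw [Real.rpow_zero, mul_one, ENNReal.ofReal_mul hγ.le]

theorem fe_anti (γ ε ε' w : ℝ) (hγ : 0 < γ) (hε : ε ≤ ε') (hw : 0 < w) : fe γ ε' w ≤ fe γ ε w := by
  unfold fe
  apply ENNReal.ofReal_le_ofReal
  gcongr ?_ * ?_
  exact Real.rpow_le_rpow_of_exponent_ge (lt_min hw one_pos) (min_le_right _ _) hε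

theorem prim_mono (f g : ℝ → ENNReal) (h : ∀ u, 0 < u → f u ≤ g u) (u : ℝ) : prim f u ≤ prim g u :=
  setLIntegral_mono' measurableSet_Ioo fun w hw => h w hw.1

theorem prim_fe_zero (γ u : ℝ) (hγ : 0 < γ) (hu : 0 < u) : prim (fe γ 0) u = ENNReal.ofReal (u ^ γ) := by
  rw [← prim_rpow γ u hγ hu]
  unfold prim
  refine lintegral_congr fun w => ?_
  rw [fe_zero γ w hγ, ENNReal.ofReal_mul hγ.le]

theorem prim_fe_small (γ ε u : ℝ) (hγ : 0 < γ) (hε : 0 ≤ ε) (hu : 0 < u) (hu1 : u ≤ 1) :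
    prim (fe γ ε) u = ENNReal.ofReal (γ / (γ + ε)) * ENNReal.ofReal (u ^ (γ + ε)) := by
  rw [← prim_rpow (γ + ε) u (by linarith) hu, ← lintegral_const_mul _ (by fun_prop)]
  unfold prim
  refine setLIntegral_congr_fun measurableSet_Ioo fun w hw => ?_
  have hw0 : 0 < w := hw.1
  simp only [fe]
  rw [← ENNReal.ofReal_mul (by positivity), min_eq_left (by linarith [hw.2]),
    show γ + ε - 1 = (γ - 1) + ε by ring, Real.rpow_add hw0]
  congr 1
  field_simp

theorem U_le_prim (d : ℕ) (a γ ε M : ℝ) (hγ : 0 < γ) (hε : 0 ≤ ε) (hM : γ + ε ≤ M) (y : Ed d) :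
    ENNReal.ofReal (γ / (γ + ε)) * UU d a (γ + 1 + ε) y ≤ LL d a (prim (fe γ ε)) y + UU d a (M + 1) y := by
  rw [UU_eq_LL, UU_eq_LL, ← LL_const_mul _ _ _ _ (by fun_prop), ← LL_add _ _ _ _ (prim_meas _)]
  refine LL_mono _ _ _ _ (fun u hu => ?_) y
  rw [show γ + 1 + ε - 1 = γ + ε by ring, show M + 1 - 1 = M by ring]
  rcases le_total u 1 with h | h
  · rw [prim_fe_small γ ε u hγ hε hu h]
    exact le_self_add
  · refine le_trans ?_ le_add_self
    calc _ ≤ 1 * ENNReal.ofReal (u ^ (γ + ε)) := by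
          gcongr
          rw [ENNReal.ofReal_le_one, div_le_one (by linarith)]; linarith
      _ ≤ _ := by
        rw [one_mul]
        exact ENNReal.ofReal_le_ofReal (Real.rpow_le_rpow_of_exponent_le h hM)

theorem G_le (d : ℕ) (a γ ε : ℝ) (hγ : 0 < γ) (hε : 0 ≤ ε) (y : Ed d) :
    LL d a (fe γ ε) y ≤ ENNReal.ofReal γ * UU d a (γ + ε) y := by
  rw [UU_eq_LL, ← LL_const_mul _ _ _ _ (by fun_prop)]
  exact LL_mono _ _ _ _ (fun u hu => fe_le γ ε u hγ hε hu) y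

theorem G_zero (d : ℕ) (a γ : ℝ) (hγ : 0 < γ) (y : Ed d) :
    LL d a (fe γ 0) y = ENNReal.ofReal γ * UU d a γ y := by
  rw [UU_eq_LL, ← LL_const_mul _ _ _ _ (by fun_prop)]
  exact LL_congr _ _ _ _ (fun u hu => fe_zero γ u hγ) y

theorem H_zero (d : ℕ) (a γ : ℝ) (hγ : 0 < γ) (y : Ed d) :
    LL d a (prim (fe γ 0)) y = UU d a (γ + 1) y := by
  rw [UU_eq_LL]
  refine LL_congr _ _ _ _ (fun u hu => ?_) y
  rw [prim_fe_zero γ u hγ hu, add_sub_cancel_right]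

/-- approximation parameters -/
def epsn (n : ℕ) : ℝ := 1 / ((n : ℝ) + 1)

theorem epsn_pos (n : ℕ) : 0 < epsn n := by unfold epsn; positivity

theorem epsn_tendsto : Tendsto epsn atTop (nhds 0) := tendsto_one_div_add_atTop_nhds_zero_nat

theorem epsn_anti : Antitone epsn := fun m n h => by
  unfold epsn
  gcongr

theorem fe_tendsto (γ w : ℝ) (hw : 0 < w) : Tendsto (fun n => fe γ (epsn n) w) atTop (nhds (fe γ 0 w)) := by
  unfold fe
  refine (ENNReal.continuous_ofReal.tendsto _).comp (Tendsto.const_mul _ ?_)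
  have hm : 0 < min w 1 := lt_min hw one_pos
  exact ((Real.continuous_const_rpow hm.ne').tendsto 0).comp epsn_tendsto

theorem prim_tendsto (γ : ℝ) (hγ : 0 < γ) (u : ℝ) :
    Tendsto (fun n => prim (fe γ (epsn n)) u) atTop (nhds (prim (fe γ 0) u)) := by
  unfold prim
  refine lintegral_tendsto_of_tendsto_of_monotone (fun n => (fe_meas _ _).aemeasurable) ?_ ?_
  · refine (ae_restrict_mem measurableSet_Ioo).mono fun w hw m n hmn => ?_
    exact fe_anti γ _ _ w hγ (epsn_anti hmn) hw.1
  · exact (ae_restrict_mem measurableSet_Ioo).mono fun w hw => fe_tendsto γ w hw.1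

theorem LL_tendsto (d : ℕ) (a : ℝ) (f : ℕ → ℝ → ENNReal) (g : ℝ → ENNReal) (hf : ∀ n, Measurable (f n))
    (hm : ∀ u, 0 < u → Monotone fun n => f n u) (ht : ∀ u, 0 < u → Tendsto (fun n => f n u) atTop (nhds (g u)))
    (hk : ∀ u (y : Ed d), kk d a u y ≠ ⊤) (y : Ed d) :
    Tendsto (fun n => LL d a (f n) y) atTop (nhds (LL d a g y)) := by
  unfold LL
  refine lintegral_tendsto_of_tendsto_of_monotone (fun n => ?_) ?_ ?_
  · have := hf n
    exact (by fun_prop : Measurable fun u => f n u * kk d a u y).aemeasurable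
  · refine (ae_restrict_mem measurableSet_Ioi).mono fun u hu m n hmn => ?_
    have := hm u hu hmn
    simp only at this ⊢
    gcongr
  · refine (ae_restrict_mem measurableSet_Ioi).mono fun u hu => ?_
    exact ENNReal.Tendsto.mul_const (ht u hu) (Or.inr (hk u y))

theorem kk_ne_top (d : ℕ) (a u : ℝ) (y : Ed d) : kk d a u y ≠ ⊤ := ENNReal.ofReal_ne_top

theorem G_tendsto (d : ℕ) (a γ : ℝ) (hγ : 0 < γ) (y : Ed d) :
    Tendsto (fun n => LL d a (fe γ (epsn n)) y) atTop (nhds (LL d a (fe γ 0) y)) :=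
  LL_tendsto d a _ _ (fun n => fe_meas _ _) (fun u hu m n hmn => fe_anti γ _ _ u hγ (epsn_anti hmn) hu)
    (fun u hu => fe_tendsto γ u hu) (fun u y => kk_ne_top d a u y) y

theorem H_tendsto (d : ℕ) (a γ : ℝ) (hγ : 0 < γ) (y : Ed d) :
    Tendsto (fun n => LL d a (prim (fe γ (epsn n))) y) atTop (nhds (LL d a (prim (fe γ 0)) y)) :=
  LL_tendsto d a _ _ (fun n => prim_meas _)
    (fun u _ m n hmn => prim_mono _ _ (fun w hw => fe_anti γ _ _ w hγ (epsn_anti hmn) hw) u)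
    (fun u _ => prim_tendsto γ hγ u) (fun u y => kk_ne_top d a u y) y


theorem ae_ne_zero (d : ℕ) (hd : 0 < d) : ∀ᵐ y : Ed d, y ≠ 0 := by
  have : Nonempty (Fin d) := ⟨⟨0, hd⟩⟩
  have : Nontrivial (Ed d) := inferInstance
  have : (volume : Measure (Ed d)) {0} = 0 := measure_singleton _
  rw [ae_iff]
  simpa using this

/-- Representation of the potentials. -/
theorem UU_rep (d : ℕ) (hd : 0 < d) (a σ : ℝ) (h0 : 0 < a) (h1 : a < 1) (hσ : 0 < σ) :
    ∀ᵐ y : Ed d, UU d a σ y =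
      ENNReal.ofReal (DD d a σ * JR (-((d : ℝ) / 2 - a * σ)) (‖y‖ ^ 2 / 4)) := by
  filter_upwards [ae_ne_zero d hd, (UU_eq_BI d a σ h0 h1 hσ).2] with y hy h
  rw [h, BI_eq _ _ (norm_ne_zero_iff.mpr hy), ENNReal.ofReal_mul (DD_pos d a σ h0 hσ).le]

theorem DD_BB (d : ℕ) (a γ ε S D : ℝ) (h0 : 0 < a) (hS : S = (d : ℝ) / 2 - a) (hγ : a * γ = S - D)
    (hp : 0 < γ + ε) :
    (γ + ε) * DD d a (γ + ε) = DD d a (γ + 1 + ε) * BB a S (D - a * ε) := by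
  unfold DD BB
  have g1 := Real.Gamma_add_one hp.ne'
  rw [show γ + 1 + ε = γ + ε + 1 by ring, g1, show S - (D - a * ε) = a * (γ + ε) by linarith,
    show a * (γ + ε + 1) = a * (γ + ε) + a by ring]
  have := (Real.Gamma_pos_of_pos (show 0 < a * (γ + ε) by positivity)).ne'
  have := (Real.Gamma_pos_of_pos (show 0 < a * (γ + ε) + a by positivity)).ne'
  field_simp

/-- The potential in extended form. -/
def QQ (d : ℕ) (a D : ℝ) (y : Ed d) : ENNReal :=
  ENNReal.ofReal (Qr a ((d : ℝ) / 2 - a) D (‖y‖ ^ 2 / 4))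

theorem norm_s_pos {d : ℕ} (y : Ed d) (hy : y ≠ 0) : 0 < ‖y‖ ^ 2 / 4 := by
  have := norm_pos_iff.mpr hy
  positivity

/-- standing hypotheses -/
structure Hyp (d : ℕ) (a D γ : ℝ) : Prop where
  h0 : 0 < a
  h1 : a < 1
  hD : 0 < D
  hDS : D ≤ ((d : ℝ) / 2 - a) / 2
  hγ : a * γ = (d : ℝ) / 2 - a - D

theorem Hyp.DltS {d : ℕ} {a D γ : ℝ} (H : Hyp d a D γ) : D < (d : ℝ) / 2 - a := by
  have := H.hD; have := H.hDS; linarith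

theorem Hyp.γpos {d : ℕ} {a D γ : ℝ} (H : Hyp d a D γ) : 0 < γ := by
  have := H.DltS; have := H.hγ
  have : 0 < a * γ := by linarith
  exact (pos_iff_pos_of_mul_pos this).mp H.h0

theorem Hyp.dpos {d : ℕ} {a D γ : ℝ} (H : Hyp d a D γ) : 0 < d := by
  have := H.DltS; have := H.hD; have := H.h0
  have : (0 : ℝ) < d := by linarith
  exact_mod_cast this

theorem repH {d : ℕ} {a D γ : ℝ} (H : Hyp d a D γ) (ε : ℝ) (hε : 0 ≤ ε) :
    ∀ᵐ y : Ed d, UU d a (γ + 1 + ε) y =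
      ENNReal.ofReal (DD d a (γ + 1 + ε) * JR (-(D - a * ε)) (‖y‖ ^ 2 / 4)) := by
  have := UU_rep d H.dpos a (γ + 1 + ε) H.h0 H.h1 (by linarith [H.γpos])
  rwa [show (d : ℝ) / 2 - a * (γ + 1 + ε) = D - a * ε by linarith [H.hγ]] at this

theorem repW {d : ℕ} {a D γ : ℝ} (H : Hyp d a D γ) (ε : ℝ) (hε : 0 ≤ ε) :
    ∀ᵐ y : Ed d, UU d a (γ + ε) y =
      ENNReal.ofReal (DD d a (γ + ε) * JR (-(D - a * ε + a)) (‖y‖ ^ 2 / 4)) := by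
  have := UU_rep d H.dpos a (γ + ε) H.h0 H.h1 (by linarith [H.γpos])
  rwa [show (d : ℝ) / 2 - a * (γ + ε) = D - a * ε + a by linarith [H.hγ]] at this

theorem rep_H0 {d : ℕ} {a D γ : ℝ} (H : Hyp d a D γ) :
    ∀ᵐ y : Ed d, UU d a (γ + 1) y = ENNReal.ofReal (DD d a (γ + 1) * JR (-D) (‖y‖ ^ 2 / 4)) := by
  simpa using repH H 0 le_rfl

theorem rep_W0 {d : ℕ} {a D γ : ℝ} (H : Hyp d a D γ) :
    ∀ᵐ y : Ed d, UU d a γ y = ENNReal.ofReal (DD d a γ * JR (-(D + a)) (‖y‖ ^ 2 / 4)) := by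
  simpa using repW H 0 le_rfl

/-- The bounded remainder -/
theorem rem_bdd {d : ℕ} {a D γ : ℝ} (H : Hyp d a D γ) :
    ∃ M C0 : ℝ, γ + 1 ≤ M ∧ 0 < C0 ∧ ∀ᵐ y : Ed d, UU d a (M + 1) y ≤ ENNReal.ofReal C0 := by
  have h0 := H.h0
  have hd : (0 : ℝ) < d := by exact_mod_cast H.dpos
  have hγ := H.γpos
  set M := γ + 1 + d / (2 * a) with hM
  have hM1 : γ + 1 ≤ M := by
    have : 0 < (d : ℝ) / (2 * a) := by positivity
    linarith
  have hk : 0 < a * (M + 1) - (d : ℝ) / 2 := by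
    rw [hM]
    have : a * ((d : ℝ) / (2 * a)) = d / 2 := by field_simp
    nlinarith
  have hDD := DD_pos d a (M + 1) h0 (by linarith)
  refine ⟨M, DD d a (M + 1) * Real.Gamma (a * (M + 1) - (d : ℝ) / 2), hM1,
    mul_pos hDD (Real.Gamma_pos_of_pos hk), ?_⟩
  filter_upwards [UU_rep d H.dpos a (M + 1) h0 H.h1 (by linarith)] with y hy
  rw [hy]
  apply ENNReal.ofReal_le_ofReal
  gcongr
  rw [show -((d : ℝ) / 2 - a * (M + 1)) = a * (M + 1) - (d : ℝ) / 2 by ring]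
  exact JR_le _ _ hk (by positivity)

/-- abbreviations -/
def HE (d : ℕ) (a γ ε : ℝ) : Ed d → ENNReal := LL d a (prim (fe γ ε))
def GE (d : ℕ) (a γ ε : ℝ) : Ed d → ENNReal := LL d a (fe γ ε)

theorem T0 {d : ℕ} {a D γ : ℝ} (H : Hyp d a D γ) :
    ∀ᵐ y : Ed d, QQ d a D y * HE d a γ 0 y = GE d a γ 0 y ∧ HE d a γ 0 y ≠ 0 ∧ HE d a γ 0 y ≠ ⊤ := by
  have h0 := H.h0
  have hγ := H.γpos
  filter_upwards [ae_ne_zero d H.dpos, rep_H0 H, rep_W0 H] with y hy e1 e2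
  have hs := norm_s_pos y hy
  set s := ‖y‖ ^ 2 / 4 with hsd
  unfold HE GE
  rw [H_zero d a γ hγ, G_zero d a γ hγ, e1, e2]
  have p1 := DD_pos d a (γ + 1) h0 (by linarith)
  have p2 := JR_pos (-D) s hs
  have p3 := Qr_pos a ((d : ℝ) / 2 - a) D s h0 H.DltS hs
  refine ⟨?_, ?_, ENNReal.ofReal_ne_top⟩
  · unfold QQ
    rw [← hsd, ← ENNReal.ofReal_mul p3.le, ← ENNReal.ofReal_mul hγ.le]
    congr 1
    have := DD_BB d a γ 0 ((d : ℝ) / 2 - a) D h0 rfl H.hγ (by linarith)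
    simp only [add_zero, mul_zero, sub_zero] at this
    rw [← mul_assoc γ, this]
    unfold Qr
    field_simp
  · exact (ENNReal.ofReal_pos.mpr (by positivity)).ne'

theorem Q_ne_top (d : ℕ) (a D : ℝ) (y : Ed d) : QQ d a D y ≠ ⊤ := ENNReal.ofReal_ne_top

theorem GE_anti {d : ℕ} {a γ : ℝ} (hγ : 0 < γ) (ε : ℝ) (hε : 0 ≤ ε) (y : Ed d) : GE d a γ ε y ≤ GE d a γ 0 y :=
  LL_mono _ _ _ _ (fun u hu => fe_anti γ _ _ u hγ hε hu) y

/-- Far estimate -/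
theorem far_W {d : ℕ} {a D γ : ℝ} (H : Hyp d a D γ) (s0 : ℝ) (hs0 : 0 < s0) (ε : ℝ) (hε : 0 ≤ ε) (hε1 : ε ≤ 1) :
    ∃ C : ℝ, 0 < C ∧ ∀ᵐ y : Ed d, s0 ≤ ‖y‖ ^ 2 / 4 →
      UU d a (γ + ε) y ≤ ENNReal.ofReal C * HE d a γ 0 y := by
  obtain ⟨C, hC, h⟩ := far_key a D s0 H.h0 H.h1 hs0
  have p1 := DD_pos d a (γ + 1) H.h0 (by linarith [H.γpos])
  have p2 := DD_pos d a (γ + ε) H.h0 (by linarith [H.γpos])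
  refine ⟨DD d a (γ + ε) * C / DD d a (γ + 1), by positivity, ?_⟩
  filter_upwards [rep_H0 H, repW H ε hε] with y e1 e2 hs
  unfold HE
  rw [H_zero d a γ H.γpos, e1, e2, ← ENNReal.ofReal_mul (by positivity)]
  apply ENNReal.ofReal_le_ofReal
  have := h ε _ hε hε1 hs
  calc _ ≤ DD d a (γ + ε) * (C * JR (-D) (‖y‖ ^ 2 / 4)) := by gcongr
    _ = _ := by field_simp

theorem T1 {d : ℕ} {a D γ : ℝ} (H : Hyp d a D γ) (ε : ℝ) (hε : 0 < ε) (hε1 : ε ≤ 1) (hε2 : a * ε ≤ D / 2) :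
    ∃ c C : ℝ, 0 < c ∧ 0 < C ∧ ∀ᵐ y : Ed d,
      ENNReal.ofReal c * UU d a (γ + ε) y + GE d a γ ε y ≤
        QQ d a D y * HE d a γ ε y + ENNReal.ofReal C * HE d a γ 0 y := by
  have h0 := H.h0
  have hγ := H.γpos
  obtain ⟨M, C0, hM, hC0, hR⟩ := rem_bdd H
  have pA := DD_pos d a (γ + 1 + ε) h0 (by linarith)
  have pW := DD_pos d a (γ + ε) h0 (by linarith)
  obtain ⟨c, s0, hc, hs0, near⟩ := near_i a ((d : ℝ) / 2 - a) D (D - a * ε) (γ / (γ + ε)) (DD d a (γ + 1 + ε)) C0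
    h0 H.hD H.hDS (by linarith) (by nlinarith) (by positivity) pA hC0
  obtain ⟨C1, hC1, f1⟩ := far_W H s0 hs0 ε hε.le hε1
  obtain ⟨C2, hC2, f2⟩ := far_W H s0 hs0 0 le_rfl zero_le_one
  refine ⟨c / DD d a (γ + ε), c / DD d a (γ + ε) * C1 + γ * C2, by positivity, by positivity, ?_⟩
  filter_upwards [ae_ne_zero d H.dpos, repH H ε hε.le, repW H ε hε.le, hR, f1, f2] with y hy e1 e2 hr g1 g2
  have hs := norm_s_pos y hy
  rcases lt_or_ge (‖y‖ ^ 2 / 4) s0 with hlt | hge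
  · refine le_trans ?_ le_self_add
    have n := near _ hs hlt
    have hQR : QQ d a D y * ENNReal.ofReal C0 ≠ ⊤ := ENNReal.mul_ne_top (Q_ne_top _ _ _ _) ENNReal.ofReal_ne_top
    rw [← ENNReal.add_le_add_iff_right hQR]
    have hU := U_le_prim d a γ ε M hγ hε.le (by linarith) y
    have pQ := Qr_pos a ((d : ℝ) / 2 - a) D _ h0 H.DltS hs
    have pB := BB_pos a ((d : ℝ) / 2 - a) (D - a * ε) h0 (by nlinarith [H.DltS])
    set s := ‖y‖ ^ 2 / 4 with hsd
    have pJ := JR_pos (-(D - a * ε + a)) s hs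
    have pJ' := JR_pos (-(D - a * ε)) s hs
    calc _ ≤ ENNReal.ofReal (c / DD d a (γ + ε)) * UU d a (γ + ε) y + ENNReal.ofReal γ * UU d a (γ + ε) y
            + QQ d a D y * ENNReal.ofReal C0 := by
          gcongr
          exact G_le d a γ ε hγ hε.le y
      _ = ENNReal.ofReal (c * JR (-(D - a * ε + a)) s
            + γ / (γ + ε) * (DD d a (γ + 1 + ε) * (BB a ((d : ℝ) / 2 - a) (D - a * ε) * JR (-(D - a * ε + a)) s))
            + Qr a ((d : ℝ) / 2 - a) D s * C0) := by
          rw [ENNReal.ofReal_add (by positivity) (by positivity), ENNReal.ofReal_add (by positivity) (by positivity),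
            ENNReal.ofReal_mul pQ.le, e2, ← ENNReal.ofReal_mul (by positivity), ← ENNReal.ofReal_mul (by positivity)]
          have := DD_BB d a γ ε ((d : ℝ) / 2 - a) D h0 rfl H.hγ (by linarith)
          congr 3
          · field_simp
          · rw [← mul_assoc (DD d a (γ + 1 + ε)), ← this]
            field_simp
      _ ≤ ENNReal.ofReal (γ / (γ + ε) * (DD d a (γ + 1 + ε) * (Qr a ((d : ℝ) / 2 - a) D s * JR (-(D - a * ε)) s))) :=
          ENNReal.ofReal_le_ofReal n
      _ = QQ d a D y * (ENNReal.ofReal (γ / (γ + ε)) * UU d a (γ + 1 + ε) y) := by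
          rw [e1]
          unfold QQ
          rw [← ENNReal.ofReal_mul (by positivity), ← ENNReal.ofReal_mul pQ.le]
          congr 1
          ring
      _ ≤ QQ d a D y * (HE d a γ ε y + ENNReal.ofReal C0) := by
          gcongr
          exact hU.trans (by unfold HE; gcongr)
      _ = _ := mul_add _ _ _
  · refine le_trans ?_ le_add_self
    rw [ENNReal.ofReal_add (by positivity) (by positivity), add_mul]
    refine add_le_add ?_ ?_
    · rw [ENNReal.ofReal_mul (by positivity), mul_assoc]
      gcongr
      exact g1 hge
    · refine (GE_anti hγ ε hε.le y).trans ?_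
      unfold GE
      rw [G_zero d a γ hγ, ENNReal.ofReal_mul (by positivity), mul_assoc]
      gcongr
      simpa using g2 hge

theorem DD_bound {d : ℕ} {a D γ : ℝ} (H : Hyp d a D γ) :
    ∃ M1 : ℝ, 0 < M1 ∧ ∀ ε : ℝ, 0 ≤ ε → ε ≤ 1 → DD d a (γ + 1 + ε) ≤ M1 := by
  have h0 := H.h0
  have hγ := H.γpos
  have hc : ContinuousOn (fun ε : ℝ => DD d a (γ + 1 + ε)) (Icc 0 1) := by
    unfold DD
    have cg : ∀ x : ℝ, 0 < x → ContinuousAt Real.Gamma x := fun x hx =>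
      (Real.differentiableAt_Gamma fun m => by
        have : (0 : ℝ) ≤ m := Nat.cast_nonneg m
        linarith).continuousAt
    intro ε hε
    have e0 := hε.1
    apply ContinuousAt.continuousWithinAt
    refine ContinuousAt.mul (ContinuousAt.div ?_ ?_ ?_) continuousAt_const
    · exact ContinuousAt.comp (f := fun ε : ℝ => γ + 1 + ε) (cg _ (by positivity)) (by fun_prop)
    · exact ContinuousAt.comp (f := fun ε : ℝ => a * (γ + 1 + ε)) (cg _ (by positivity)) (by fun_prop)
    · exact (Real.Gamma_pos_of_pos (by positivity)).ne'
  obtain ⟨M, hM⟩ := isCompact_Icc.exists_bound_of_continuousOn hc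
  have hp : ∀ ε : ℝ, 0 ≤ ε → ε ≤ 1 → DD d a (γ + 1 + ε) ≤ M := fun ε h h' => (le_abs_self _).trans (hM ε ⟨h, h'⟩)
  refine ⟨M, ?_, hp⟩
  exact lt_of_lt_of_le (DD_pos d a (γ + 1 + 0) h0 (by linarith)) (hp 0 le_rfl zero_le_one)

theorem T2 {d : ℕ} {a D γ : ℝ} (H : Hyp d a D γ) :
    ∃ ε0 C : ℝ, 0 < ε0 ∧ ε0 ≤ 1 ∧ a * ε0 ≤ D / 2 ∧ 0 < C ∧ ∀ ε : ℝ, 0 < ε → ε ≤ ε0 → ∀ᵐ y : Ed d,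
      GE d a γ ε y ≤ QQ d a D y * HE d a γ ε y +
        ENNReal.ofReal C * (UU d a (γ + ε0) y + HE d a γ 0 y) := by
  have h0 := H.h0
  have hγ := H.γpos
  obtain ⟨M, C0, hM, hC0, hR⟩ := rem_bdd H
  obtain ⟨M1, hM1, hDD⟩ := DD_bound H
  obtain ⟨ε0, hε0, hε01, hε02, C, hC, near⟩ := near_ii a ((d : ℝ) / 2 - a) D C0 M1 h0 H.hD H.hDS hC0 hM1
  obtain ⟨C2, hC2, f2⟩ := far_W H 1 one_pos 0 le_rfl zero_le_one
  have pW0 := DD_pos d a (γ + ε0) h0 (by linarith)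
  refine ⟨ε0, C / DD d a (γ + ε0) + γ * C2, hε0, hε01, hε02, by positivity, fun ε hε hεε => ?_⟩
  have pA := DD_pos d a (γ + 1 + ε) h0 (by linarith)
  have pW := DD_pos d a (γ + ε) h0 (by linarith)
  filter_upwards [ae_ne_zero d H.dpos, repH H ε hε.le, repW H ε hε.le, repW H ε0 hε0.le, hR, f2]
    with y hy e1 e2 e3 hr g2
  have hs := norm_s_pos y hy
  rcases le_or_gt (‖y‖ ^ 2 / 4) 1 with hlt | hge
  · have hae : a * ε ≤ D / 2 := le_trans (by gcongr) hε02
    have n := near ε (γ / (γ + ε)) (DD d a (γ + 1 + ε)) _ hε hεε (by positivity)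
      (by rw [div_le_one (by positivity)]; linarith) pA (hDD ε hε.le (by linarith)) hs hlt
    have hQR : QQ d a D y * ENNReal.ofReal C0 ≠ ⊤ := ENNReal.mul_ne_top (Q_ne_top _ _ _ _) ENNReal.ofReal_ne_top
    rw [← ENNReal.add_le_add_iff_right hQR]
    have hU := U_le_prim d a γ ε M hγ hε.le (by linarith) y
    have pQ := Qr_pos a ((d : ℝ) / 2 - a) D _ h0 H.DltS hs
    have pB := BB_pos a ((d : ℝ) / 2 - a) (D - a * ε) h0 (by nlinarith [H.DltS])
    set s := ‖y‖ ^ 2 / 4 with hsd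
    have pJ := JR_pos (-(D - a * ε + a)) s hs
    have pJ0 := JR_pos (-(D - a * ε0 + a)) s hs
    have pJ' := JR_pos (-(D - a * ε)) s hs
    calc _ ≤ ENNReal.ofReal γ * UU d a (γ + ε) y
            + QQ d a D y * ENNReal.ofReal C0 := by
          gcongr
          exact G_le d a γ ε hγ hε.le y
      _ = ENNReal.ofReal (
            γ / (γ + ε) * (DD d a (γ + 1 + ε) * (BB a ((d : ℝ) / 2 - a) (D - a * ε) * JR (-(D - a * ε + a)) s))
            + Qr a ((d : ℝ) / 2 - a) D s * C0) := by
          rw [ENNReal.ofReal_add (by positivity) (by positivity),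
            ENNReal.ofReal_mul pQ.le, e2, ← ENNReal.ofReal_mul (by positivity)]
          have := DD_BB d a γ ε ((d : ℝ) / 2 - a) D h0 rfl H.hγ (by linarith)
          congr 2
          rw [← mul_assoc (DD d a (γ + 1 + ε)), ← this]
          field_simp
      _ ≤ ENNReal.ofReal (γ / (γ + ε) * (DD d a (γ + 1 + ε) * (Qr a ((d : ℝ) / 2 - a) D s * JR (-(D - a * ε)) s))
            + C * JR (-(D - a * ε0 + a)) s) :=
          ENNReal.ofReal_le_ofReal n
      _ = QQ d a D y * (ENNReal.ofReal (γ / (γ + ε)) * UU d a (γ + 1 + ε) y)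
            + ENNReal.ofReal (C / DD d a (γ + ε0)) * UU d a (γ + ε0) y := by
          rw [e1, e3]
          unfold QQ
          rw [← ENNReal.ofReal_mul (by positivity), ← ENNReal.ofReal_mul pQ.le, ← ENNReal.ofReal_mul (by positivity),
            ← ENNReal.ofReal_add (by positivity) (by positivity)]
          congr 1
          field_simp
      _ ≤ QQ d a D y * (HE d a γ ε y + ENNReal.ofReal C0) +
            ENNReal.ofReal (C / DD d a (γ + ε0) + γ * C2) * (UU d a (γ + ε0) y + HE d a γ 0 y) := by
          gcongr
          · exact hU.trans (by unfold HE; gcongr)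
          · have : 0 < γ * C2 := by positivity
            linarith
          · exact le_self_add
      _ = _ := by ring
  · refine le_trans ?_ le_add_self
    refine (GE_anti hγ ε hε.le y).trans ?_
    calc GE d a γ 0 y = ENNReal.ofReal γ * UU d a γ y := by unfold GE; rw [G_zero d a γ hγ]
      _ ≤ ENNReal.ofReal γ * (ENNReal.ofReal C2 * HE d a γ 0 y) := by
          gcongr
          simpa using g2 hge.le
      _ = ENNReal.ofReal (γ * C2) * HE d a γ 0 y := by rw [← mul_assoc, ← ENNReal.ofReal_mul hγ.le]
      _ ≤ _ := by
          gcongr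
          · have : 0 < C / DD d a (γ + ε0) := by positivity
            linarith
          · exact le_add_self

/-- pointwise finiteness -/
theorem HE_fin {d : ℕ} {a D γ : ℝ} (H : Hyp d a D γ) (x : Ed d) (hx : x ≠ 0) : HE d a γ 0 x ≠ ⊤ := by
  have hT := T0 H
  have hpos : 0 < volume (Metric.ball (0 : Ed d) ‖x‖) := Metric.measure_ball_pos _ _ (norm_pos_iff.mpr hx)
  obtain ⟨y, hy, hy2⟩ := (frequently_ae_mem_iff.mpr hpos.ne').and_eventually hT |>.exists
  refine ne_top_of_le_ne_top hy2.2.2 ?_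
  unfold HE LL
  refine setLIntegral_mono' measurableSet_Ioi fun u hu => ?_
  gcongr
  exact kk_mono d a u H.h0 H.h1 hu _ _ (by simpa using (mem_ball_zero_iff.mp hy).le)


theorem lint_Ioo_meas {X : Type*} [MeasurableSpace X] (F : ℝ → X → ℝ → ENNReal)
    (hF : Measurable fun p : (ℝ × X) × ℝ => F p.1.1 p.1.2 p.2) :
    Measurable fun p : ℝ × X => ∫⁻ s in Ioo (0 : ℝ) p.1, F p.1 p.2 s := by
  have e : (fun p : ℝ × X => ∫⁻ s in Ioo (0 : ℝ) p.1, F p.1 p.2 s) =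
      fun p : ℝ × X => ∫⁻ s, ({r : (ℝ × X) × ℝ | 0 < r.2 ∧ r.2 < r.1.1}.indicator
        (fun r => F r.1.1 r.1.2 r.2)) (p, s) := by
    funext p
    rw [← lintegral_indicator measurableSet_Ioo]
    rfl
  rw [e]
  apply Measurable.lintegral_prod_right
  refine hF.indicator ?_
  exact (measurableSet_lt measurable_const measurable_snd).inter
    (measurableSet_lt measurable_snd (measurable_fst.comp measurable_fst))

/-- Tonelli on the triangle. -/
theorem tri (t : ℝ) (F : ℝ → ℝ → ENNReal) (hF : Measurable fun p : ℝ × ℝ => F p.1 p.2) :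
    ∫⁻ u in Ioo (0 : ℝ) t, ∫⁻ s in Ioo (0 : ℝ) u, F u s =
      ∫⁻ s in Ioo (0 : ℝ) t, ∫⁻ r in Ioo (0 : ℝ) (t - s), F (s + r) s := by
  set I : ℝ → ℝ → ENNReal := fun u s => {p : ℝ × ℝ | 0 < p.2 ∧ p.2 < p.1 ∧ p.1 < t}.indicator
    (fun p => F p.1 p.2) (u, s) with hI
  have mI : Measurable fun p : ℝ × ℝ => I p.1 p.2 := by
    refine hF.indicator ?_
    exact (measurableSet_lt measurable_const measurable_snd).inter
      ((measurableSet_lt measurable_snd measurable_fst).inter (measurableSet_lt measurable_fst measurable_const))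
  have e1 : ∫⁻ u in Ioo (0 : ℝ) t, ∫⁻ s in Ioo (0 : ℝ) u, F u s = ∫⁻ u, ∫⁻ s, I u s := by
    rw [← lintegral_indicator measurableSet_Ioo]
    refine lintegral_congr fun u => ?_
    by_cases hu : u ∈ Ioo (0 : ℝ) t
    · rw [indicator_of_mem hu, ← lintegral_indicator measurableSet_Ioo]
      refine lintegral_congr fun s => ?_
      simp only [hI, indicator, mem_Ioo, mem_ofPred_eq]
      have := hu.2
      congr 1
      simp [this]
    · rw [indicator_of_notMem hu]
      symm
      rw [lintegral_eq_zero_iff (by fun_prop)]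
      refine Eventually.of_forall fun s => ?_
      simp only [hI, indicator, mem_ofPred_eq, Pi.zero_apply]
      rw [if_neg]
      rintro ⟨h1, h2, h3⟩
      exact hu ⟨h1.trans h2, h3⟩
  have e2 : ∫⁻ s in Ioo (0 : ℝ) t, ∫⁻ r in Ioo (0 : ℝ) (t - s), F (s + r) s = ∫⁻ s, ∫⁻ u, I u s := by
    rw [← lintegral_indicator measurableSet_Ioo]
    refine lintegral_congr fun s => ?_
    by_cases hu : s ∈ Ioo (0 : ℝ) t
    · rw [indicator_of_mem hu, ← lintegral_indicator measurableSet_Ioo, ← lintegral_add_left_eq_self (fun u => I u s) s]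
      refine lintegral_congr fun r => ?_
      simp only [hI, indicator, mem_Ioo, mem_ofPred_eq]
      have := hu.1
      congr 1
      simp [this, lt_sub_iff_add_lt']
    · rw [indicator_of_notMem hu]
      symm
      rw [lintegral_eq_zero_iff (by fun_prop)]
      refine Eventually.of_forall fun u => ?_
      simp only [hI, indicator, mem_ofPred_eq, Pi.zero_apply]
      rw [if_neg]
      rintro ⟨h1, h2, h3⟩
      exact hu ⟨h1, h2.trans h3⟩
  rw [e1, e2, lintegral_lintegral_swap mI.aemeasurable]

/-- Semigroup applied to a superposition. -/
theorem sg_LL (d : ℕ) (a s : ℝ) (h0 : 0 < a) (h1 : a < 1) (hs : 0 < s) (g : ℝ → ENNReal) (hg : Measurable g)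
    (z : Ed d) : ∫⁻ y, kk d a s (y - z) * LL d a g y = ∫⁻ u in Ioi (0 : ℝ), g u * kk d a (s + u) z := by
  unfold LL
  have m1 : Measurable fun p : Ed d × ℝ => kk d a s (p.1 - z) * (g p.2 * kk d a p.2 p.1) := by
    have := (kk_meas d a).comp (measurable_snd.prodMk measurable_fst : Measurable fun p : Ed d × ℝ => (p.2, p.1))
    have h2 := kk_meas1 d a s
    exact (h2.comp (measurable_fst.sub measurable_const)).mul ((hg.comp measurable_snd).mul this)
  calc _ = ∫⁻ y, ∫⁻ u in Ioi (0 : ℝ), kk d a s (y - z) * (g u * kk d a u y) := by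
        refine lintegral_congr fun y => ?_
        rw [lintegral_const_mul]
        have := kk_meas d a
        fun_prop
    _ = ∫⁻ u in Ioi (0 : ℝ), ∫⁻ y, kk d a s (y - z) * (g u * kk d a u y) :=
        lintegral_lintegral_swap m1.aemeasurable
    _ = _ := by
        refine setLIntegral_congr_fun measurableSet_Ioi fun u hu => ?_
        have := kk_ck d a s u h0 h1 hs hu z 0
        rw [zero_sub, kk_neg] at this
        show _ = g u * kk d a (s + u) z
        rw [← this, ← lintegral_const_mul]
        · refine lintegral_congr fun y => ?_
          rw [zero_sub, kk_neg]
          ring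
        · have := kk_meas1 d a s
          have := kk_meas1 d a u
          fun_prop

/-- Superposition of the primitive. -/
theorem prim_shift (f k : ℝ → ENNReal) (hf : Measurable f) (hk : Measurable k) (s : ℝ) :
    ∫⁻ u in Ioi (0 : ℝ), prim f u * k (s + u) = ∫⁻ w in Ioi (0 : ℝ), f w * ∫⁻ v in Ioi (s + w), k v := by
  set I : ℝ → ℝ → ENNReal := fun u w => {p : ℝ × ℝ | 0 < p.2 ∧ p.2 < p.1}.indicator
    (fun p => f p.2 * k (s + p.1)) (u, w) with hI
  have mI : Measurable fun p : ℝ × ℝ => I p.1 p.2 := by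
    refine Measurable.indicator (by fun_prop) ?_
    exact (measurableSet_lt measurable_const measurable_snd).inter (measurableSet_lt measurable_snd measurable_fst)
  have e1 : ∫⁻ u in Ioi (0 : ℝ), prim f u * k (s + u) = ∫⁻ u, ∫⁻ s, I u s := by
    rw [← lintegral_indicator measurableSet_Ioi]
    refine lintegral_congr fun u => ?_
    by_cases hu : u ∈ Ioi (0 : ℝ)
    · rw [indicator_of_mem hu]
      unfold prim
      rw [← lintegral_mul_const _ hf, ← lintegral_indicator measurableSet_Ioo]
      rfl
    · rw [indicator_of_notMem hu]
      symm
      rw [lintegral_eq_zero_iff (by fun_prop)]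
      refine Eventually.of_forall fun s => ?_
      simp only [hI, indicator, mem_ofPred_eq, Pi.zero_apply]
      rw [if_neg]
      rintro ⟨h1, h2⟩
      exact hu (h1.trans h2)
  have e2 : ∫⁻ w in Ioi (0 : ℝ), f w * ∫⁻ v in Ioi (s + w), k v = ∫⁻ w, ∫⁻ u, I u w := by
    rw [← lintegral_indicator measurableSet_Ioi]
    refine lintegral_congr fun w => ?_
    by_cases hu : w ∈ Ioi (0 : ℝ)
    · rw [indicator_of_mem hu, ← lintegral_const_mul _ hk, ← lintegral_indicator measurableSet_Ioi,
        ← lintegral_add_left_eq_self _ s]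
      refine lintegral_congr fun r => ?_
      simp only [hI, indicator, mem_Ioi, mem_ofPred_eq]
      have : 0 < w := hu
      simp [this]
    · rw [indicator_of_notMem hu]
      symm
      rw [lintegral_eq_zero_iff (by fun_prop)]
      refine Eventually.of_forall fun u => ?_
      simp only [hI, indicator, mem_ofPred_eq, Pi.zero_apply]
      rw [if_neg]
      rintro ⟨h1, h2⟩
      exact hu h1
  rw [e1, e2, lintegral_lintegral_swap mI.aemeasurable]

/-- Duhamel identity. -/
theorem duhamel (d : ℕ) (a s : ℝ) (h0 : 0 < a) (h1 : a < 1) (hs : 0 < s) (f : ℝ → ENNReal) (hf : Measurable f)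
    (z : Ed d) :
    (∫⁻ y, kk d a s (y - z) * LL d a (prim f) y) +
      ∫⁻ r in Ioo (0 : ℝ) s, ∫⁻ y, kk d a r (y - z) * LL d a f y = LL d a (prim f) z := by
  have mk : Measurable fun v => kk d a v z := (kk_meas d a).comp (measurable_id.prodMk measurable_const)
  rw [sg_LL d a s h0 h1 hs _ (prim_meas f), prim_shift f _ hf mk s]
  have e : LL d a (prim f) z = ∫⁻ u in Ioi (0 : ℝ), prim f u * kk d a (0 + u) z := by
    unfold LL; simp
  rw [e, prim_shift f _ hf mk 0]
  have e2 : ∫⁻ r in Ioo (0 : ℝ) s, ∫⁻ y, kk d a r (y - z) * LL d a f y =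
      ∫⁻ w in Ioi (0 : ℝ), f w * ∫⁻ v in Ioc w (s + w), kk d a v z := by
    calc _ = ∫⁻ r in Ioo (0 : ℝ) s, ∫⁻ w in Ioi (0 : ℝ), f w * kk d a (r + w) z :=
          setLIntegral_congr_fun measurableSet_Ioo fun r hr => sg_LL d a r h0 h1 hr.1 f hf z
      _ = ∫⁻ w in Ioi (0 : ℝ), ∫⁻ r in Ioo (0 : ℝ) s, f w * kk d a (r + w) z := by
          apply lintegral_lintegral_swap
          have : Measurable fun p : ℝ × ℝ => f p.2 * kk d a (p.1 + p.2) z :=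
            (hf.comp measurable_snd).mul (mk.comp (measurable_fst.add measurable_snd))
          exact this.aemeasurable
      _ = _ := by
          refine lintegral_congr fun w => ?_
          rw [lintegral_const_mul _ (by fun_prop)]
          congr 1
          rw [setLIntegral_congr (Ioo_ae_eq_Ioc (μ := volume)), ← lintegral_indicator measurableSet_Ioc,
            ← lintegral_indicator measurableSet_Ioc, ← lintegral_add_right_eq_self ((Ioc w (s + w)).indicator fun v => kk d a v z) w]
          refine lintegral_congr fun r => ?_
          simp only [indicator, mem_Ioc]
          simp
  have mt : ∀ c : ℝ, Measurable fun w : ℝ => ∫⁻ v in Ioi (c + w), kk d a v z := fun c => by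
    have : Antitone fun w : ℝ => ∫⁻ v in Ioi (c + w), kk d a v z := fun w w' h =>
      lintegral_mono_set (Ioi_subset_Ioi (by linarith))
    exact this.measurable
  rw [e2, ← lintegral_add_left (show Measurable fun w => f w * ∫⁻ v in Ioi (s + w), kk d a v z from hf.mul (mt s))]
  refine lintegral_congr fun w => ?_
  rw [← mul_add, zero_add, add_comm, ← lintegral_union measurableSet_Ioi]
  · rw [Ioc_union_Ioi_eq_Ioi (by linarith)]
  · exact Ioc_disjoint_Ioi le_rfl

/-- Perturbation series in extended nonnegative reals. -/
def PN (d : ℕ) (a : ℝ) (q : Ed d → ENNReal) (x : Ed d) : ℕ → ℝ → Ed d → ENNReal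
  | 0 => fun t y => kk d a t (y - x)
  | n + 1 => fun t y => ∫⁻ s in Ioo (0 : ℝ) t, ∫⁻ z : Ed d, PN d a q x n s z * q z * kk d a (t - s) (y - z)

theorem PN_meas (d : ℕ) (a : ℝ) (q : Ed d → ENNReal) (hq : Measurable q) (x : Ed d) (n : ℕ) :
    Measurable fun p : ℝ × Ed d => PN d a q x n p.1 p.2 := by
  induction n with
  | zero => exact (kk_meas d a).comp (measurable_fst.prodMk (measurable_snd.sub_const x))
  | succ n ih =>
    refine lint_Ioo_meas (fun t y s => ∫⁻ z : Ed d, PN d a q x n s z * q z * kk d a (t - s) (y - z)) ?_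
    have : Measurable fun p : ((ℝ × Ed d) × ℝ) × Ed d =>
        PN d a q x n p.1.2 p.2 * q p.2 * kk d a (p.1.1.1 - p.1.2) (p.1.1.2 - p.2) := by
      refine ((ih.comp ((measurable_snd.comp measurable_fst).prodMk measurable_snd)).mul (hq.comp measurable_snd)).mul ?_
      exact (kk_meas d a).comp (Measurable.prodMk (by fun_prop) (by fun_prop))
    exact this.lintegral_prod_right

/-- time-integrated weights -/
def wN (d : ℕ) (a : ℝ) (q : Ed d → ENNReal) (x : Ed d) (t : ℝ) (n : ℕ) (y : Ed d) : ENNReal :=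
  ∫⁻ u in Ioo (0 : ℝ) t, PN d a q x n u y

theorem wN_meas (d : ℕ) (a : ℝ) (q : Ed d → ENNReal) (hq : Measurable q) (x : Ed d) (t : ℝ) (n : ℕ) :
    Measurable (wN d a q x t n) := by
  unfold wN
  exact (PN_meas d a q hq x n).lintegral_prod_left

theorem wN_int (d : ℕ) (a : ℝ) (q : Ed d → ENNReal) (hq : Measurable q) (x : Ed d) (t : ℝ) (n : ℕ)
    (f : Ed d → ENNReal) (hf : Measurable f) :
    ∫⁻ y, wN d a q x t n y * f y = ∫⁻ u in Ioo (0 : ℝ) t, ∫⁻ y, PN d a q x n u y * f y := by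
  have hm := PN_meas d a q hq x n
  have e : ∫⁻ y, wN d a q x t n y * f y = ∫⁻ y, ∫⁻ u in Ioo (0 : ℝ) t, PN d a q x n u y * f y := by
    refine lintegral_congr fun y => ?_
    unfold wN
    rw [lintegral_mul_const]
    exact hm.comp (measurable_id.prodMk measurable_const)
  rw [e]
  refine lintegral_lintegral_swap ?_
  exact ((hm.comp (measurable_snd.prodMk measurable_fst)).mul (hf.comp measurable_fst)).aemeasurable

theorem PN_succ_int (d : ℕ) (a : ℝ) (q : Ed d → ENNReal) (hq : Measurable q) (x : Ed d) (t : ℝ) (n : ℕ)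
    (f : Ed d → ENNReal) (hf : Measurable f) :
    ∫⁻ y, PN d a q x (n + 1) t y * f y =
      ∫⁻ s in Ioo (0 : ℝ) t, ∫⁻ z, PN d a q x n s z * q z * ∫⁻ y, kk d a (t - s) (y - z) * f y := by
  have hm := PN_meas d a q hq x n
  have hk := kk_meas d a
  have m3 : Measurable fun p : (Ed d × ℝ) × Ed d =>
      PN d a q x n p.1.2 p.2 * q p.2 * kk d a (t - p.1.2) (p.1.1 - p.2) := by
    refine ((hm.comp ((measurable_snd.comp measurable_fst).prodMk measurable_snd)).mul (hq.comp measurable_snd)).mul ?_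
    exact hk.comp (Measurable.prodMk (by fun_prop) (by fun_prop))
  have m2 := m3.lintegral_prod_right' (ν := (volume : Measure (Ed d)))
  calc _ = ∫⁻ y, ∫⁻ s in Ioo (0 : ℝ) t, (∫⁻ z, PN d a q x n s z * q z * kk d a (t - s) (y - z)) * f y := by
        refine lintegral_congr fun y => ?_
        rw [lintegral_mul_const]
        · rfl
        · exact m2.comp (measurable_const.prodMk measurable_id)
    _ = ∫⁻ s in Ioo (0 : ℝ) t, ∫⁻ y, (∫⁻ z, PN d a q x n s z * q z * kk d a (t - s) (y - z)) * f y :=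
        lintegral_lintegral_swap (m2.mul (hf.comp measurable_fst)).aemeasurable
    _ = _ := by
        refine lintegral_congr fun s => ?_
        have m4 : Measurable fun p : Ed d × Ed d => PN d a q x n s p.2 * q p.2 * kk d a (t - s) (p.1 - p.2) :=
          m3.comp ((measurable_fst.prodMk measurable_const).prodMk measurable_snd)
        calc _ = ∫⁻ y, ∫⁻ z, PN d a q x n s z * q z * kk d a (t - s) (y - z) * f y := by
              refine lintegral_congr fun y => ?_
              rw [lintegral_mul_const]
              exact m4.comp (measurable_const.prodMk measurable_id)
          _ = ∫⁻ z, ∫⁻ y, PN d a q x n s z * q z * kk d a (t - s) (y - z) * f y :=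
              lintegral_lintegral_swap (m4.mul (hf.comp measurable_fst)).aemeasurable
          _ = _ := by
              refine lintegral_congr fun z => ?_
              rw [← lintegral_const_mul]
              · simp_rw [mul_assoc]
              · have := kk_meas1 d a (t - s)
                fun_prop

/-- Basic identities -/
theorem id_zero (d : ℕ) (a : ℝ) (h0 : 0 < a) (h1 : a < 1) (q : Ed d → ENNReal) (hq : Measurable q) (x : Ed d)
    (t : ℝ) (ht : 0 < t) (f : ℝ → ENNReal) (hf : Measurable f) :
    (∫⁻ y, PN d a q x 0 t y * LL d a (prim f) y) + ∫⁻ y, wN d a q x t 0 y * LL d a f y = LL d a (prim f) x := by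
  rw [wN_int d a q hq x t 0 _ (LL_meas d a f hf)]
  exact duhamel d a t h0 h1 ht f hf x

theorem id_succ (d : ℕ) (a : ℝ) (h0 : 0 < a) (h1 : a < 1) (q : Ed d → ENNReal) (hq : Measurable q) (x : Ed d)
    (t : ℝ) (f : ℝ → ENNReal) (hf : Measurable f) (n : ℕ) :
    (∫⁻ y, PN d a q x (n + 1) t y * LL d a (prim f) y) + ∫⁻ y, wN d a q x t (n + 1) y * LL d a f y =
      ∫⁻ y, wN d a q x t n y * (q y * LL d a (prim f) y) := by
  have hG := LL_meas d a f hf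
  have hH := LL_meas d a (prim f) (prim_meas f)
  have hm := PN_meas d a q hq x n
  have hk := kk_meas d a
  rw [wN_int d a q hq x t _ _ hG, wN_int d a q hq x t n (fun y => q y * LL d a (prim f) y) (hq.mul hH), PN_succ_int d a q hq x t n _ hH]
  have mA : Measurable fun p : ℝ × Ed d => ∫⁻ y, kk d a p.1 (y - p.2) * LL d a f y := by
    have : Measurable fun r : (ℝ × Ed d) × Ed d => kk d a r.1.1 (r.2 - r.1.2) * LL d a f r.2 :=
      (by fun_prop : Measurable fun r : (ℝ × Ed d) × Ed d => kk d a r.1.1 (r.2 - r.1.2)).mul (hG.comp measurable_snd)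
    exact this.lintegral_prod_right
  have e : ∫⁻ u in Ioo (0 : ℝ) t, ∫⁻ y, PN d a q x (n + 1) u y * LL d a f y =
      ∫⁻ s in Ioo (0 : ℝ) t, ∫⁻ z, PN d a q x n s z * q z *
        ∫⁻ r in Ioo (0 : ℝ) (t - s), ∫⁻ y, kk d a r (y - z) * LL d a f y := by
    simp_rw [PN_succ_int d a q hq x _ n _ hG]
    rw [tri t (fun u s => ∫⁻ z, PN d a q x n s z * q z * ∫⁻ y, kk d a (u - s) (y - z) * LL d a f y)]
    · refine lintegral_congr fun s => ?_
      simp_rw [add_sub_cancel_left]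
      rw [lintegral_lintegral_swap]
      · refine lintegral_congr fun z => ?_
        rw [lintegral_const_mul]
        exact mA.comp (measurable_id.prodMk measurable_const)
      · have : Measurable fun p : ℝ × Ed d => PN d a q x n s p.2 * q p.2 * ∫⁻ y, kk d a p.1 (y - p.2) * LL d a f y :=
          ((hm.comp (measurable_const.prodMk measurable_snd)).mul (hq.comp measurable_snd)).mul mA
        exact this.aemeasurable
    · have : Measurable fun p : (ℝ × ℝ) × Ed d => PN d a q x n p.1.2 p.2 * q p.2 *
          ∫⁻ y, kk d a (p.1.1 - p.1.2) (y - p.2) * LL d a f y := by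
        refine ((hm.comp ((measurable_snd.comp measurable_fst).prodMk measurable_snd)).mul (hq.comp measurable_snd)).mul ?_
        exact mA.comp (Measurable.prodMk (by fun_prop) (by fun_prop))
      exact this.lintegral_prod_right
  rw [e]
  have mB : Measurable fun p : ℝ × Ed d => PN d a q x n p.1 p.2 * q p.2 * ∫⁻ y, kk d a (t - p.1) (y - p.2) * LL d a (prim f) y := by
    refine (hm.mul (hq.comp measurable_snd)).mul ?_
    have : Measurable fun r : (ℝ × Ed d) × Ed d => kk d a (t - r.1.1) (r.2 - r.1.2) * LL d a (prim f) r.2 :=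
      (by fun_prop : Measurable fun r : (ℝ × Ed d) × Ed d => kk d a (t - r.1.1) (r.2 - r.1.2)).mul (hH.comp measurable_snd)
    exact this.lintegral_prod_right
  rw [← lintegral_add_left mB.lintegral_prod_right']
  refine setLIntegral_congr_fun measurableSet_Ioo fun s hs => ?_
  have mC : Measurable fun z => PN d a q x n s z * q z * ∫⁻ y, kk d a (t - s) (y - z) * LL d a (prim f) y :=
    mB.comp (measurable_const.prodMk measurable_id)
  refine (lintegral_add_left mC _).symm.trans ?_
  refine lintegral_congr fun z => ?_
  rw [← mul_add, duhamel d a (t - s) h0 h1 (by linarith [hs.2]) f hf z, mul_assoc]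


theorem JR_meas (ν : ℝ) : Measurable (JR ν) := by
  unfold JR
  have : StronglyMeasurable (fun q : ℝ × ℝ => jf ν q.1 q.2) := by
    unfold jf
    exact Measurable.stronglyMeasurable (by fun_prop)
  exact (this.integral_prod_right' (ν := volume.restrict (Ioi (0 : ℝ)))).measurable

theorem QQ_meas (d : ℕ) (a D : ℝ) : Measurable (QQ d a D) := by
  unfold QQ Qr
  have h1 := JR_meas (-(D + a))
  have h2 := JR_meas (-D)
  exact (((h1.comp (by fun_prop : Measurable fun y : Ed d => ‖y‖ ^ 2 / 4)).const_mul _).div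
    (h2.comp (by fun_prop : Measurable fun y : Ed d => ‖y‖ ^ 2 / 4))).ennreal_ofReal

theorem HE_meas (d : ℕ) (a γ ε : ℝ) : Measurable (HE d a γ ε) := LL_meas d a _ (prim_meas _)
theorem GE_meas (d : ℕ) (a γ ε : ℝ) : Measurable (GE d a γ ε) := LL_meas d a _ (fe_meas _ _)

theorem HE_anti {d : ℕ} {a γ : ℝ} (hγ : 0 < γ) (ε : ℝ) (hε : 0 ≤ ε) (y : Ed d) : HE d a γ ε y ≤ HE d a γ 0 y :=
  LL_mono _ _ _ _ (fun u _ => prim_mono _ _ (fun w hw => fe_anti γ _ _ w hγ hε hw) u) y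

/-- summed identity for parameter zero -/
theorem sum_zero {d : ℕ} {a D γ : ℝ} (H : Hyp d a D γ) (x : Ed d) (t : ℝ) (ht : 0 < t) (N : ℕ) :
    (∑ n ∈ Finset.range (N + 1), ∫⁻ y, PN d a (QQ d a D) x n t y * HE d a γ 0 y) +
      ∫⁻ y, wN d a (QQ d a D) x t N y * GE d a γ 0 y = HE d a γ 0 x := by
  have hq := QQ_meas d a D
  induction N with
  | zero => simpa [HE, GE] using id_zero d a H.h0 H.h1 _ hq x t ht (fe γ 0) (fe_meas _ _)
  | succ N ih =>
    have := id_succ d a H.h0 H.h1 _ hq x t (fe γ 0) (fe_meas _ _) N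
    rw [Finset.sum_range_succ, add_assoc]
    unfold HE GE at *
    rw [this, ← ih]
    congr 1
    refine lintegral_congr_ae ?_
    filter_upwards [T0 H] with y hy
    have := hy.1
    unfold HE GE at this
    rw [this]

theorem sum_eps {d : ℕ} {a D γ : ℝ} (H : Hyp d a D γ) (x : Ed d) (t : ℝ) (ht : 0 < t) (ε : ℝ) (N : ℕ) :
    (∑ n ∈ Finset.range (N + 1), ∫⁻ y, PN d a (QQ d a D) x n t y * HE d a γ ε y) +
      ∑ n ∈ Finset.range (N + 1), ∫⁻ y, wN d a (QQ d a D) x t n y * GE d a γ ε y = HE d a γ ε x +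
      ∑ n ∈ Finset.range N, ∫⁻ y, wN d a (QQ d a D) x t n y * (QQ d a D y * HE d a γ ε y) := by
  have hq := QQ_meas d a D
  induction N with
  | zero => simpa [HE, GE] using id_zero d a H.h0 H.h1 _ hq x t ht (fe γ ε) (fe_meas _ _)
  | succ N ih =>
    have := id_succ d a H.h0 H.h1 _ hq x t (fe γ ε) (fe_meas _ _) N
    rw [Finset.sum_range_succ _ (N + 1), Finset.sum_range_succ _ (N + 1), add_add_add_comm, ih,
      Finset.sum_range_succ _ N]
    unfold HE GE
    rw [this, add_assoc]

theorem sum_a_le {d : ℕ} {a D γ : ℝ} (H : Hyp d a D γ) (x : Ed d) (t : ℝ) (ht : 0 < t) :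
    ∑' n, ∫⁻ y, PN d a (QQ d a D) x n t y * HE d a γ 0 y ≤ HE d a γ 0 x := by
  refine ENNReal.tsum_le_of_sum_range_le fun N => ?_
  rw [← sum_zero H x t ht N]
  refine le_trans ?_ le_self_add
  exact Finset.sum_le_sum_of_subset (Finset.range_mono (by lia))

theorem b_le {d : ℕ} {a D γ : ℝ} (H : Hyp d a D γ) (x : Ed d) (t : ℝ) (ht : 0 < t) (ε : ℝ) (hε : 0 ≤ ε) (n : ℕ) :
    ∫⁻ y, wN d a (QQ d a D) x t n y * GE d a γ ε y ≤ HE d a γ 0 x := by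
  rw [← sum_zero H x t ht n]
  refine le_trans ?_ le_add_self
  refine lintegral_mono fun y => ?_
  have := GE_anti (d := d) (a := a) H.γpos ε hε y
  show _ * _ ≤ _ * _
  gcongr

theorem c_le {d : ℕ} {a D γ : ℝ} (H : Hyp d a D γ) (x : Ed d) (t : ℝ) (ht : 0 < t) (ε : ℝ) (hε : 0 ≤ ε) (n : ℕ) :
    ∫⁻ y, wN d a (QQ d a D) x t n y * (QQ d a D y * HE d a γ ε y) ≤ HE d a γ 0 x := by
  refine le_trans ?_ (b_le H x t ht 0 le_rfl n)
  refine lintegral_mono_ae ?_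
  filter_upwards [T0 H] with y hy
  rw [← hy.1]
  have := HE_anti (d := d) (a := a) H.γpos ε hε y
  gcongr

theorem wH_le {d : ℕ} {a D γ : ℝ} (H : Hyp d a D γ) (x : Ed d) (t : ℝ) :
    ∑' n, ∫⁻ y, wN d a (QQ d a D) x t n y * HE d a γ 0 y ≤ ENNReal.ofReal t * HE d a γ 0 x := by
  have hq := QQ_meas d a D
  have hH := HE_meas d a γ 0
  simp_rw [wN_int d a _ hq x t _ _ hH]
  rw [← lintegral_tsum]
  · calc _ ≤ ∫⁻ u in Ioo (0 : ℝ) t, HE d a γ 0 x :=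
          setLIntegral_mono' measurableSet_Ioo fun u hu => sum_a_le H x u hu.1
      _ = _ := by
          rw [setLIntegral_const, Real.volume_Ioo, sub_zero, mul_comm]
  · intro n
    have : Measurable fun p : ℝ × Ed d => PN d a (QQ d a D) x n p.1 p.2 * HE d a γ 0 p.2 :=
      (PN_meas d a _ hq x n).mul (hH.comp measurable_snd)
    exact this.lintegral_prod_right'.aemeasurable

theorem UU_meas {d : ℕ} {a D γ : ℝ} (H : Hyp d a D γ) (ε : ℝ) (hε : 0 ≤ ε) : Measurable (UU d a (γ + ε)) :=
  (UU_eq_BI d a (γ + ε) H.h0 H.h1 (by linarith [H.γpos])).1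

theorem wW_fin {d : ℕ} {a D γ : ℝ} (H : Hyp d a D γ) (x : Ed d) (hx : x ≠ 0) (t : ℝ) (ht : 0 < t)
    (ε : ℝ) (hε : 0 < ε) (hε1 : ε ≤ 1) (hε2 : a * ε ≤ D / 2) :
    ∑' n, ∫⁻ y, wN d a (QQ d a D) x t n y * UU d a (γ + ε) y ≠ ⊤ := by
  obtain ⟨c, C, hc, hC, hT⟩ := T1 H ε hε hε1 hε2
  have hq := QQ_meas d a D
  have hH0 := HE_meas d a γ 0
  have hHe := HE_meas d a γ ε
  have hW := UU_meas H ε hε.le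
  have hw := wN_meas d a _ hq x t
  have hGe := GE_meas d a γ ε
  have hfin := HE_fin H x hx
  set X := HE d a γ 0 x with hX
  set A := fun n => ∫⁻ y, wN d a (QQ d a D) x t n y * UU d a (γ + ε) y with hA
  set b := fun n => ∫⁻ y, wN d a (QQ d a D) x t n y * GE d a γ ε y with hb
  set cc := fun n => ∫⁻ y, wN d a (QQ d a D) x t n y * (QQ d a D y * HE d a γ ε y) with hcc
  set h := fun n => ∫⁻ y, wN d a (QQ d a D) x t n y * HE d a γ 0 y with hh
  have key : ∀ n, ENNReal.ofReal c * A n + b n ≤ cc n + ENNReal.ofReal C * h n := fun n => by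
    simp only [hA, hb, hcc, hh]
    have hwn := hw n
    rw [← lintegral_const_mul _ (by fun_prop), ← lintegral_const_mul _ (by fun_prop),
      ← lintegral_add_left (by fun_prop), ← lintegral_add_left (by fun_prop)]
    refine lintegral_mono_ae ?_
    filter_upwards [hT] with y hy
    calc _ = wN d a (QQ d a D) x t n y * (ENNReal.ofReal c * UU d a (γ + ε) y + GE d a γ ε y) := by ring
      _ ≤ wN d a (QQ d a D) x t n y * (QQ d a D y * HE d a γ ε y + ENNReal.ofReal C * HE d a γ 0 y) := by gcongr
      _ = _ := by ring
  have bound : ENNReal.ofReal c * ∑' n, A n ≤ X + X + ENNReal.ofReal C * (ENNReal.ofReal t * X) := by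
    rw [← ENNReal.tsum_mul_left]
    refine ENNReal.tsum_le_of_sum_range_le fun N => ?_
    have bf : ∑ n ∈ Finset.range N, b n ≠ ⊤ :=
      ENNReal.sum_ne_top.mpr fun n _ => ne_top_of_le_ne_top hfin (b_le H x t ht ε hε.le n)
    rw [← ENNReal.add_le_add_iff_right bf]
    calc _ = ∑ n ∈ Finset.range N, (ENNReal.ofReal c * A n + b n) := Finset.sum_add_distrib.symm
      _ ≤ ∑ n ∈ Finset.range N, (cc n + ENNReal.ofReal C * h n) := Finset.sum_le_sum fun n _ => key n
      _ = ∑ n ∈ Finset.range N, cc n + ENNReal.ofReal C * ∑ n ∈ Finset.range N, h n := by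
          rw [Finset.sum_add_distrib, Finset.mul_sum]
      _ ≤ (X + (∑ n ∈ Finset.range N, b n + X)) + ENNReal.ofReal C * (ENNReal.ofReal t * X) := by
          gcongr
          · refine le_trans (le_add_self : _ ≤ HE d a γ ε x + _) ?_
            rw [← sum_eps H x t ht ε N]
            refine add_le_add ?_ ?_
            · refine le_trans ?_ (sum_a_le H x t ht)
              refine le_trans (Finset.sum_le_sum fun n _ => ?_) (ENNReal.sum_le_tsum _)
              refine lintegral_mono fun y => ?_
              have := HE_anti (d := d) (a := a) H.γpos ε hε.le y
              show _ * _ ≤ _ * _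
              gcongr
            · rw [Finset.sum_range_succ]
              gcongr
              exact b_le H x t ht ε hε.le N
          · exact (ENNReal.sum_le_tsum _).trans (wH_le H x t)
      _ = _ := by ring
  have fin2 : X + X + ENNReal.ofReal C * (ENNReal.ofReal t * X) ≠ ⊤ := by finiteness
  intro htop
  have hA' : ∑' n, A n = ⊤ := htop
  rw [hA', ENNReal.mul_top (ENNReal.ofReal_pos.mpr hc).ne'] at bound
  exact fin2 (top_le_iff.mp bound)

theorem step_eps {d : ℕ} {a D γ : ℝ} (H : Hyp d a D γ) (x : Ed d) (hx : x ≠ 0) (t : ℝ) (ht : 0 < t)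
    (ε : ℝ) (hε : 0 < ε) (hε1 : ε ≤ 1) (hε2 : a * ε ≤ D / 2) :
    HE d a γ ε x ≤ (∑' n, ∫⁻ y, PN d a (QQ d a D) x n t y * HE d a γ 0 y) +
      ∑' n, ∫⁻ y, wN d a (QQ d a D) x t n y * (GE d a γ ε y - QQ d a D y * HE d a γ ε y) := by
  have hq := QQ_meas d a D
  have hHe := HE_meas d a γ ε
  have hW := UU_meas H ε hε.le
  have hw := wN_meas d a _ hq x t
  have hGe := GE_meas d a γ ε
  have hfin := HE_fin H x hx
  set X := HE d a γ 0 x with hX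
  set b := fun n => ∫⁻ y, wN d a (QQ d a D) x t n y * GE d a γ ε y with hb
  set cc := fun n => ∫⁻ y, wN d a (QQ d a D) x t n y * (QQ d a D y * HE d a γ ε y) with hcc
  set A := fun n => ∫⁻ y, PN d a (QQ d a D) x n t y * HE d a γ 0 y with hA
  set E := fun n => ∫⁻ y, wN d a (QQ d a D) x t n y * (GE d a γ ε y - QQ d a D y * HE d a γ ε y) with hE
  have key : ∀ n, b n ≤ cc n + E n := fun n => by
    simp only [hb, hcc, hE]
    have hwn := hw n
    rw [← lintegral_add_left (by fun_prop)]
    refine lintegral_mono fun y => ?_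
    show _ ≤ _ * _ + _ * _
    rw [← mul_add]
    gcongr
    exact le_add_tsub
  have hbz : Tendsto b atTop (nhds 0) := by
    have h1 := ENNReal.tendsto_atTop_zero_of_tsum_ne_top (wW_fin H x hx t ht ε hε hε1 hε2)
    have h2 := ENNReal.Tendsto.const_mul (a := ENNReal.ofReal γ) h1 (Or.inr ENNReal.ofReal_ne_top)
    rw [mul_zero] at h2
    refine tendsto_of_tendsto_of_tendsto_of_le_of_le tendsto_const_nhds h2 (fun _ => zero_le) fun n => ?_
    have hwn := hw n
    simp only [hb]
    rw [← lintegral_const_mul _ (by fun_prop)]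
    refine lintegral_mono fun y => ?_
    have := G_le d a γ ε H.γpos hε.le y
    calc _ ≤ wN d a (QQ d a D) x t n y * (ENNReal.ofReal γ * UU d a (γ + ε) y) := by
          unfold GE
          gcongr
      _ = _ := by ring
  have main : ∀ N, HE d a γ ε x ≤ (∑' n, A n) + (∑' n, E n) + b N := fun N => by
    have cf : ∑ n ∈ Finset.range N, cc n ≠ ⊤ :=
      ENNReal.sum_ne_top.mpr fun n _ => ne_top_of_le_ne_top hfin (c_le H x t ht ε hε.le n)
    rw [← ENNReal.add_le_add_iff_right cf, ← sum_eps H x t ht ε N]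
    rw [Finset.sum_range_succ (fun n => ∫⁻ y, wN d a (QQ d a D) x t n y * GE d a γ ε y) N]
    calc _ ≤ (∑' n, A n) + (∑ n ∈ Finset.range N, (cc n + E n) + b N) := by
          refine add_le_add ?_ ?_
          · refine le_trans (Finset.sum_le_sum fun n _ => ?_) (ENNReal.sum_le_tsum _)
            refine lintegral_mono fun y => ?_
            have := HE_anti (d := d) (a := a) H.γpos ε hε.le y
            show _ * _ ≤ _ * _
            gcongr
          · gcongr with n hn
            exact key n
      _ = (∑' n, A n) + (∑ n ∈ Finset.range N, E n) + b N + ∑ n ∈ Finset.range N, cc n := by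
          rw [Finset.sum_add_distrib]; ring
      _ ≤ _ := by
          gcongr
          exact ENNReal.sum_le_tsum _
  have lim := tendsto_const_nhds (x := (∑' n, A n) + (∑' n, E n)) |>.add hbz
  rw [add_zero] at lim
  exact ge_of_tendsto' lim main

/-- Invariance in extended form. -/
theorem invariance {d : ℕ} {a D γ : ℝ} (H : Hyp d a D γ) (x : Ed d) (hx : x ≠ 0) (t : ℝ) (ht : 0 < t) :
    ∑' n, ∫⁻ y, PN d a (QQ d a D) x n t y * HE d a γ 0 y = HE d a γ 0 x := by
  refine le_antisymm (sum_a_le H x t ht) ?_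
  obtain ⟨ε0, C, hε0, hε01, hε02, hC, hT⟩ := T2 H
  have hq := QQ_meas d a D
  have hH0 := HE_meas d a γ 0
  have hW := UU_meas H ε0 hε0.le
  have hw := wN_meas d a _ hq x t
  have hfin := HE_fin H x hx
  set A := ∑' n, ∫⁻ y, PN d a (QQ d a D) x n t y * HE d a γ 0 y with hA
  set w := fun y => ∑' n, wN d a (QQ d a D) x t n y with hwd
  have hwm : Measurable w := Measurable.tsum hw
  have hsum : ∀ f : Ed d → ENNReal, Measurable f → ∑' n, ∫⁻ y, wN d a (QQ d a D) x t n y * f y = ∫⁻ y, w y * f y := by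
    intro f hf
    rw [← lintegral_tsum fun n =>
      (show Measurable fun y => wN d a (QQ d a D) x t n y * f y from (hw n).mul hf).aemeasurable]
    refine lintegral_congr fun y => ?_
    rw [ENNReal.tsum_mul_right]
  set Dk := fun (k : ℕ) y => GE d a γ (epsn k) y - QQ d a D y * HE d a γ (epsn k) y with hDk
  have hDm : ∀ k, Measurable (Dk k) := fun k => by
    have := GE_meas d a γ (epsn k)
    have := HE_meas d a γ (epsn k)
    simp only [hDk]
    fun_prop
  have hbfin : ∫⁻ y, w y * (ENNReal.ofReal C * (UU d a (γ + ε0) y + HE d a γ 0 y)) ≠ ⊤ := by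
    have e : ∫⁻ y, w y * (ENNReal.ofReal C * (UU d a (γ + ε0) y + HE d a γ 0 y)) =
        ENNReal.ofReal C * ((∫⁻ y, w y * UU d a (γ + ε0) y) + ∫⁻ y, w y * HE d a γ 0 y) := by
      rw [← lintegral_add_left (by fun_prop), ← lintegral_const_mul _ (by fun_prop)]
      refine lintegral_congr fun y => ?_
      ring
    rw [e, ← hsum _ hW, ← hsum _ hH0]
    have h1 := wW_fin H x hx t ht ε0 hε0 hε01 hε02
    have h2 : ∑' n, ∫⁻ y, wN d a (QQ d a D) x t n y * HE d a γ 0 y ≠ ⊤ :=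
      ne_top_of_le_ne_top (by finiteness) (wH_le H x t)
    finiteness
  have hev : ∀ᶠ k in atTop, epsn k ≤ ε0 := epsn_tendsto.eventually_le_const hε0
  have hlim : Tendsto (fun k => ∫⁻ y, w y * Dk k y) atTop (nhds 0) := by
    have := tendsto_lintegral_filter_of_dominated_convergence (μ := (volume : Measure (Ed d)))
      (F := fun k y => w y * Dk k y) (f := fun _ => 0) (l := atTop)
      (fun y => w y * (ENNReal.ofReal C * (UU d a (γ + ε0) y + HE d a γ 0 y)))
      (Eventually.of_forall fun k => hwm.mul (hDm k)) ?_ hbfin ?_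
    · simpa using this
    · filter_upwards [hev] with k hk
      filter_upwards [hT (epsn k) (epsn_pos k) hk] with y hy
      gcongr
      simp only [hDk]
      exact tsub_le_iff_left.mpr hy
    · have hlt := ae_lt_top (by fun_prop) hbfin
      filter_upwards [hlt, T0 H] with y h1 h2
      have wfin : w y ≠ ⊤ := by
        intro hw'
        rw [hw', ENNReal.top_mul] at h1
        · exact lt_irrefl _ h1
        · have := (ENNReal.ofReal_pos.mpr hC).ne'
          have := h2.2.1
          simp_all
      have g := G_tendsto d a γ H.γpos y
      have hh := H_tendsto d a γ H.γpos y
      have gt : GE d a γ 0 y ≠ ⊤ := by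
        rw [← h2.1]
        exact ENNReal.mul_ne_top (Q_ne_top d a D y) h2.2.2
      have l1 := ENNReal.Tendsto.sub g (ENNReal.Tendsto.const_mul (a := QQ d a D y) hh (Or.inr (Q_ne_top d a D y))) (Or.inl gt)
      have e0 : LL d a (fe γ 0) y - QQ d a D y * LL d a (prim (fe γ 0)) y = 0 := by
        have := h2.1
        unfold HE GE at this
        rw [this, tsub_self]
      rw [e0] at l1
      have l2 := ENNReal.Tendsto.const_mul (a := w y) l1 (Or.inr wfin)
      rw [mul_zero] at l2
      exact l2
  have hstep : ∀ᶠ k in atTop, HE d a γ (epsn k) x ≤ A + ∫⁻ y, w y * Dk k y := by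
    filter_upwards [hev] with k hk
    rw [← hsum _ (hDm k)]
    refine step_eps H x hx t ht (epsn k) (epsn_pos k) (hk.trans hε01) (le_trans ?_ hε02)
    have := H.h0
    gcongr
  have lim2 := tendsto_const_nhds (x := A) |>.add hlim
  rw [add_zero] at lim2
  exact le_of_tendsto_of_tendsto (H_tendsto d a γ H.γpos x) lim2 hstep


theorem Vbeta_eq (d : ℕ) (α δ : ℝ) (y : Ed d) (hy : y ≠ 0) :
    Vbeta d α δ y = Qr (α / 2) ((d : ℝ) / 2 - α / 2) (δ / 2) (‖y‖ ^ 2 / 4) := by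
  have hr := norm_pos_iff.mpr hy
  have hs := norm_s_pos y hy
  unfold Vbeta VProf Qr BB
  rw [besselK_eq, besselK_eq]
  have e1 : (δ + α) / 2 = δ / 2 + α / 2 := by ring
  rw [e1, Real.rpow_add (by positivity : 0 < ‖y‖ / 2), Real.div_rpow hr.le (by norm_num) (α / 2), Real.rpow_neg hr.le,
    show (d : ℝ) / 2 - α / 2 - δ / 2 + α / 2 = ((d : ℝ) - δ) / 2 by ring,
    show (d : ℝ) / 2 - α / 2 - δ / 2 = ((d : ℝ) - δ - α) / 2 by ring]
  have p1 : (‖y‖ / 2) ^ (δ / 2) ≠ 0 := by positivity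
  have p2 : ‖y‖ ^ (α / 2) ≠ 0 := by positivity
  have p3 : (2 : ℝ) ^ (α / 2) ≠ 0 := by positivity
  have p4 := (JR_pos (-(δ / 2)) _ hs).ne'
  by_cases hG : Real.Gamma (((d : ℝ) - δ - α) / 2) = 0
  · simp [hG]
  field_simp

theorem hyp_of (d : ℕ) (α δ : ℝ) (hα : α ∈ Ioo 0 (min 2 (d : ℝ)))
    (hδ : δ ∈ Ioc 0 (((d : ℝ) - α) / 2)) : Hyp d (α / 2) (δ / 2) (((d : ℝ) - α - δ) / α) := by
  have h0 := hα.1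
  have h2 := lt_min_iff.mp hα.2
  have h3 := hδ.1
  have h4 := hδ.2
  refine ⟨by linarith, by linarith, by linarith, by linarith, ?_⟩
  field_simp

theorem hBeta_eq (d : ℕ) (α δ : ℝ) (hα : α ∈ Ioo 0 (min 2 (d : ℝ)))
    (hδ : δ ∈ Ioc 0 (((d : ℝ) - α) / 2)) (y : Ed d) :
    hBeta d α δ y = (HE d (α / 2) (((d : ℝ) - α - δ) / α) 0 y).toReal := by
  have H := hyp_of d α δ hα hδ
  set γ := ((d : ℝ) - α - δ) / α with hγ
  unfold hBeta hBetaM HE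
  rw [H_zero d (α / 2) γ H.γpos, ← hγ]
  have e : (fun t : ℝ => t ^ γ * relKernel d α 1 t y 0) = fun t : ℝ => t ^ γ * pk d (α / 2) t y := by
    funext t
    rw [relKernel_eq, zero_sub, pk_neg]
  rw [e]
  have hm : Measurable fun t : ℝ => t ^ γ * pk d (α / 2) t y := by
    have : Measurable fun t : ℝ => pk d (α / 2) t y := (pk_meas d (α / 2)).comp (measurable_id.prodMk measurable_const)
    fun_prop
  rw [integral_eq_lintegral_of_nonneg_ae _ hm.aestronglyMeasurable]
  · congr 1
    unfold UU
    refine setLIntegral_congr_fun measurableSet_Ioi fun t ht => ?_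
    have h0 : 0 < t := ht
    show ENNReal.ofReal (t ^ γ * pk d (α / 2) t y) = _
    rw [ENNReal.ofReal_mul (by positivity), add_sub_cancel_right]
    rfl
  · refine (ae_restrict_mem measurableSet_Ioi).mono fun t ht => ?_
    have h0 : 0 < t := ht
    exact mul_nonneg (by positivity) (pk_nonneg d (α / 2) t H.h0 H.h1 h0 y)

theorem PN_fin {d : ℕ} {a D γ : ℝ} (H : Hyp d a D γ) (x : Ed d) (hx : x ≠ 0) (t : ℝ) (ht : 0 < t) (n : ℕ) :
    ∀ᵐ y : Ed d, PN d a (QQ d a D) x n t y < ⊤ := by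
  have hq := QQ_meas d a D
  have hm : Measurable (PN d a (QQ d a D) x n t) :=
    (PN_meas d a _ hq x n).comp (measurable_const.prodMk measurable_id)
  have hH := HE_meas d a γ 0
  have hle : ∫⁻ y, PN d a (QQ d a D) x n t y * HE d a γ 0 y ≠ ⊤ :=
    ne_top_of_le_ne_top (HE_fin H x hx) ((ENNReal.le_tsum n).trans (sum_a_le H x t ht))
  filter_upwards [ae_lt_top (by fun_prop) hle, T0 H] with y h1 h2
  rw [lt_top_iff_ne_top]
  intro h
  rw [h, ENNReal.top_mul h2.2.1] at h1
  exact lt_irrefl _ h1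

theorem pertN_eq (d : ℕ) (α δ : ℝ) (hα : α ∈ Ioo 0 (min 2 (d : ℝ)))
    (hδ : δ ∈ Ioc 0 (((d : ℝ) - α) / 2)) (x : Ed d) (hx : x ≠ 0) (n : ℕ) :
    ∀ t : ℝ, 0 < t → ∀ᵐ y : Ed d, pertN d (relKernel d α 1) (Vbeta d α δ) n t x y =
      (PN d (α / 2) (QQ d (α / 2) (δ / 2)) x n t y).toReal := by
  have H := hyp_of d α δ hα hδ
  have hq := QQ_meas d (α / 2) (δ / 2)
  have kr : ∀ t : ℝ, 0 < t → ∀ x y : Ed d, relKernel d α 1 t x y = (kk d (α / 2) t (y - x)).toReal := by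
    intro t ht x y
    rw [relKernel_eq]
    unfold kk
    rw [ENNReal.toReal_ofReal (pk_nonneg d (α / 2) t H.h0 H.h1 ht _)]
  induction n with
  | zero =>
    intro t ht
    exact Eventually.of_forall fun y => kr t ht x y
  | succ n ih =>
    intro t ht
    have hm := PN_meas d (α / 2) _ hq x n
    filter_upwards [PN_fin H x hx t ht (n + 1)] with y hy
    have m2 : Measurable fun p : ℝ × Ed d => PN d (α / 2) (QQ d (α / 2) (δ / 2)) x n p.1 p.2 *
        QQ d (α / 2) (δ / 2) p.2 * kk d (α / 2) (t - p.1) (y - p.2) := by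
      refine (hm.mul (hq.comp measurable_snd)).mul ?_
      fun_prop
    have m1 := m2.lintegral_prod_right' (ν := (volume : Measure (Ed d)))
    have inner : ∀ s ∈ Ioo (0 : ℝ) t, (∫ z : Ed d, pertN d (relKernel d α 1) (Vbeta d α δ) n s x z *
        Vbeta d α δ z * relKernel d α 1 (t - s) z y) =
        (∫⁻ z : Ed d, PN d (α / 2) (QQ d (α / 2) (δ / 2)) x n s z *
          QQ d (α / 2) (δ / 2) z * kk d (α / 2) (t - s) (y - z)).toReal := by
      intro s hs
      rw [← integral_toReal]
      · refine integral_congr_ae ?_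
        filter_upwards [ih s hs.1, ae_ne_zero d H.dpos] with z hz hz0
        rw [hz, kr (t - s) (by linarith [hs.2]), Vbeta_eq d α δ z hz0, ENNReal.toReal_mul, ENNReal.toReal_mul]
        congr 2
        unfold QQ
        rw [ENNReal.toReal_ofReal]
        exact (Qr_pos _ _ _ _ H.h0 H.DltS (norm_s_pos z hz0)).le
      · exact (m2.comp (measurable_const.prodMk measurable_id)).aemeasurable
      · filter_upwards [PN_fin H x hx s hs.1 n] with z hz
        exact ENNReal.mul_lt_top (ENNReal.mul_lt_top hz ENNReal.ofReal_lt_top) ENNReal.ofReal_lt_top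
    show (∫ s in Ioo (0 : ℝ) t, ∫ z : Ed d, pertN d (relKernel d α 1) (Vbeta d α δ) n s x z *
        Vbeta d α δ z * relKernel d α 1 (t - s) z y) = (∫⁻ s in Ioo (0 : ℝ) t, ∫⁻ z : Ed d,
        PN d (α / 2) (QQ d (α / 2) (δ / 2)) x n s z *
          QQ d (α / 2) (δ / 2) z * kk d (α / 2) (t - s) (y - z)).toReal
    rw [setIntegral_congr_fun measurableSet_Ioo inner]
    refine integral_toReal m1.aemeasurable ?_
    exact ae_lt_top m1 hy.ne


/-- Invariance of `h_δ` under the perturbed semigroup (Theorem 4.8). -/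
theorem stmt_3 (d : ℕ) (α δ : ℝ) (hα : α ∈ Ioo 0 (min 2 (d : ℝ)))
    (hδ : δ ∈ Ioc 0 (((d : ℝ) - α) / 2)) (t : ℝ) (ht : 0 < t) (x : Ed d) (hx : x ≠ 0) :
    (∫ y : Ed d, pert d (relKernel d α 1) (Vbeta d α δ) t x y * hBeta d α δ y) =
      hBeta d α δ x := by
  have H := hyp_of d α δ hα hδ
  have hq := QQ_meas d (α / 2) (δ / 2)
  have inv := invariance H x hx t ht
  rw [hBeta_eq d α δ hα hδ x]
  set γ := ((d : ℝ) - α - δ) / α with hγ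
  have hH := HE_meas d (α / 2) γ 0
  have hm : ∀ n, Measurable (PN d (α / 2) (QQ d (α / 2) (δ / 2)) x n t) := fun n =>
    (PN_meas d (α / 2) _ hq x n).comp (measurable_const.prodMk measurable_id)
  have hms : Measurable fun y => ∑' n, PN d (α / 2) (QQ d (α / 2) (δ / 2)) x n t y := Measurable.tsum hm
  have e : ∫⁻ y, (∑' n, PN d (α / 2) (QQ d (α / 2) (δ / 2)) x n t y) * HE d (α / 2) γ 0 y = HE d (α / 2) γ 0 x := by
    rw [← inv, ← lintegral_tsum fun n =>
      (show Measurable fun y => PN d (α / 2) (QQ d (α / 2) (δ / 2)) x n t y * HE d (α / 2) γ 0 y from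
        (hm n).mul hH).aemeasurable]
    refine lintegral_congr fun y => ?_
    rw [ENNReal.tsum_mul_right]
  have hfin := HE_fin H x hx
  rw [← e] at hfin ⊢
  have hmm : Measurable fun y => (∑' n, PN d (α / 2) (QQ d (α / 2) (δ / 2)) x n t y) * HE d (α / 2) γ 0 y := hms.mul hH
  rw [← integral_toReal hmm.aemeasurable (ae_lt_top hmm hfin)]
  refine integral_congr_ae ?_
  have h1 := ae_all_iff.mpr fun n => pertN_eq d α δ hα hδ x hx n t ht
  have h2 := ae_all_iff.mpr fun n => PN_fin H x hx t ht n
  filter_upwards [h1, h2] with y hy1 hy2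
  show _ = ENNReal.toReal (_ * _)
  rw [ENNReal.toReal_mul, hBeta_eq d α δ hα hδ y, ENNReal.tsum_toReal_eq fun n => (hy2 n).ne]
  unfold pert
  simp_rw [hy1]
  rfl
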